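/- arXiv:math/9404214 — 2 statements merged into one kernel-verified Lean document; each statement's English description precedes it below -/
import Mathlib

section
/- Let E be a Banach space, k a positive integer, and let u be an element of the k-fold symmetric projective tensor product of E. Then for every δ > 0 there exist a sequence (xᵢ) in E and signs εᵢ ∈ {−1, +1} such that Σᵢ ‖xᵢ‖ᵏ ≤ (kᵏ/k!)(‖u‖ + δ) (in particular Σᵢ ‖xᵢ‖ᵏ < ∞) and u = Σᵢ εᵢ xᵢ⊗⋯⊗xᵢ (k factors), the series converging in norm. -/
open Filter Topology NormedSpace

noncomputable section

/-- `X`, together with the continuous multilinear map `ι`, is (an isometric copy of) the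
projective tensor product of the family `E`. -/
structure IsProjTensorProductPi {n : ℕ} (E : Fin n → Type*) (X : Type*)
    [∀ i, NormedAddCommGroup (E i)] [∀ i, NormedSpace ℝ (E i)]
    [NormedAddCommGroup X] [NormedSpace ℝ X] [CompleteSpace X]
    (ι : ContinuousMultilinearMap ℝ E X) : Prop where
  norm_le : ∀ x, ‖ι x‖ ≤ ∏ i, ‖x i‖
  dense_span : Dense (Submodule.span ℝ (Set.range ι) : Set X)
  lift : ∀ (G : Type*) [NormedAddCommGroup G] [NormedSpace ℝ G] [CompleteSpace G]
    (A : ContinuousMultilinearMap ℝ E G),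
    ∃ T : X →L[ℝ] G, ‖T‖ ≤ ‖A‖ ∧ ∀ x, T (ι x) = A x

/-- The closed linear span of the diagonal elementary tensors inside a `k`-fold projective
tensor product of `E` with itself: the `k`-fold symmetric projective tensor product of `E`. -/
def symTensor {k : ℕ} {E X : Type*} [NormedAddCommGroup E] [NormedSpace ℝ E]
    [NormedAddCommGroup X] [NormedSpace ℝ X]
    (ι : ContinuousMultilinearMap ℝ (fun _ : Fin k => E) X) : Submodule ℝ X :=
  (Submodule.span ℝ {u : X | ∃ x : E, u = ι (fun _ => x)}).topologicalClosure

/-- A product of signs over all indices, times the product of the signs picked by `r`, averages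
to zero unless `r` is onto. -/
lemma sum_sign_prod_eq_zero {α : Type*} [Fintype α] [DecidableEq α] (r : α → α)
    (hr : ¬ Function.Surjective r) :
    ∑ e : α → ℤˣ, (∏ i, ((e i : ℤ) : ℝ)) * ∏ j, ((e (r j) : ℤ) : ℝ) = 0 := by
  obtain ⟨i₀, hi₀⟩ : ∃ i, ∀ j, r j ≠ i := by simpa [Function.Surjective] using hr
  have key : ∑ e : α → ℤˣ, (∏ i, ((e i : ℤ) : ℝ)) * ∏ j, ((e (r j) : ℤ) : ℝ) =
      ∑ e : α → ℤˣ, -((∏ i, ((e i : ℤ) : ℝ)) * ∏ j, ((e (r j) : ℤ) : ℝ)) := by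
    refine Fintype.sum_equiv (Equiv.mulLeft (Pi.mulSingle i₀ (-1))) _ _ fun e => ?_
    have h₁ : ∀ j, (Pi.mulSingle i₀ (-1 : ℤˣ) : α → ℤˣ) (r j) = 1 := fun j =>
      Pi.mulSingle_eq_of_ne (hi₀ j) _
    have h₂ : ∏ i, (((Pi.mulSingle i₀ (-1 : ℤˣ) : α → ℤˣ) i : ℤ) : ℝ) = -1 := by
      rw [Finset.prod_eq_single i₀]
      · simp
      · intro i _ hi
        simp [Pi.mulSingle_eq_of_ne hi]
      · simp
    simp [Finset.prod_mul_distrib, h₁, h₂]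
  rw [Finset.sum_neg_distrib] at key
  linarith

/-- The polarization formula with signs. -/
lemma polarization_signs {k : ℕ} {E : Type*} [NormedAddCommGroup E] [NormedSpace ℝ E]
    (f : ContinuousMultilinearMap ℝ (fun _ : Fin k => E) ℝ) (x : Fin k → E) :
    ∑ e : Fin k → ℤˣ, (∏ i, ((e i : ℤ) : ℝ)) * f (fun _ => ∑ i, ((e i : ℤ) : ℝ) • x i) =
      2 ^ k * ∑ σ : Equiv.Perm (Fin k), f (fun i => x (σ i)) := by
  have expand : ∀ e : Fin k → ℤˣ, f (fun _ => ∑ i, ((e i : ℤ) : ℝ) • x i) =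
      ∑ r : Fin k → Fin k, (∏ j, ((e (r j) : ℤ) : ℝ)) * f (fun j => x (r j)) := by
    intro e
    rw [f.map_sum (fun _ i => ((e i : ℤ) : ℝ) • x i)]
    refine Finset.sum_congr rfl fun r _ => ?_
    rw [f.map_smul_univ (fun j => ((e (r j) : ℤ) : ℝ)) (fun j => x (r j)), smul_eq_mul]
  simp_rw [expand, Finset.mul_sum]
  rw [Finset.sum_comm]
  symm
  refine Fintype.sum_of_injective (fun σ : Equiv.Perm (Fin k) => (σ : Fin k → Fin k))
    DFunLike.coe_injective _ _ (fun r hr => ?_) (fun σ => ?_)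
  · simp_rw [← mul_assoc]
    rw [← Finset.sum_mul, sum_sign_prod_eq_zero, zero_mul]
    intro hs
    exact hr ⟨Equiv.ofBijective r (Finite.surjective_iff_bijective.mp hs), rfl⟩
  · have h : ∀ e : Fin k → ℤˣ,
        (∏ i, ((e i : ℤ) : ℝ)) * ∏ j, ((e (σ j) : ℤ) : ℝ) = 1 := by
      intro e
      rw [Equiv.prod_comp σ (fun i => ((e i : ℤ) : ℝ)), ← Finset.prod_mul_distrib]
      refine Finset.prod_eq_one fun i _ => ?_
      rcases Int.units_eq_one_or (e i) with h | h <;> simp [h]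
    simp_rw [← mul_assoc, h]
    simp

/-- The polarization inequality: the symmetrization of a multilinear form is bounded by
`k ^ k / k !` times a bound for the form on the diagonal. -/
lemma norm_symmetrization_le {k : ℕ} {E : Type*} [NormedAddCommGroup E] [NormedSpace ℝ E]
    (f : ContinuousMultilinearMap ℝ (fun _ : Fin k => E) ℝ) {M : ℝ} (hM : 0 ≤ M)
    (hf : ∀ y : E, |f (fun _ => y)| ≤ M * ‖y‖ ^ k) :
    ‖∑ σ : Equiv.Perm (Fin k), f.domDomCongr σ‖ ≤ (k : ℝ) ^ k * M := by
  set S := ∑ σ : Equiv.Perm (Fin k), f.domDomCongr σ with hS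
  have hSapp : ∀ x, S x = ∑ σ : Equiv.Perm (Fin k), f (fun i => x (σ i)) := by
    intro x
    simp [hS]
  have unit : ∀ x : Fin k → E, (∀ i, ‖x i‖ ≤ 1) → ‖S x‖ ≤ (k : ℝ) ^ k * M := by
    intro x hx
    have h := polarization_signs f x
    rw [← hSapp] at h
    have hsign : ∀ a : ℤˣ, |((a : ℤ) : ℝ)| = 1 := by
      intro a
      rcases Int.units_eq_one_or a with h | h <;> simp [h]
    have h' : |(2 : ℝ) ^ k * S x| ≤ 2 ^ k * ((k : ℝ) ^ k * M) := by
      rw [← h]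
      refine (Finset.abs_sum_le_sum_abs _ _).trans ?_
      have : ∀ e ∈ (Finset.univ : Finset (Fin k → ℤˣ)),
          |(∏ i, ((e i : ℤ) : ℝ)) * f (fun _ => ∑ i, ((e i : ℤ) : ℝ) • x i)| ≤
            (k : ℝ) ^ k * M := by
        intro e _
        have hn : ‖∑ i, ((e i : ℤ) : ℝ) • x i‖ ≤ k := by
          refine (norm_sum_le _ _).trans ?_
          refine (Finset.sum_le_card_nsmul _ _ 1 fun i _ => ?_).trans (by simp)
          rw [norm_smul, Real.norm_eq_abs, hsign, one_mul]
          exact hx i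
        rw [abs_mul, Finset.abs_prod]
        simp only [hsign, Finset.prod_const_one, one_mul]
        refine (hf _).trans ?_
        rw [mul_comm]
        gcongr
      refine (Finset.sum_le_card_nsmul _ _ _ this).trans ?_
      simp [Finset.card_univ, Fintype.card_units_int]
    rw [abs_mul, abs_of_pos (by positivity : (0 : ℝ) < 2 ^ k)] at h'
    exact le_of_mul_le_mul_left h' (by positivity)
  refine ContinuousMultilinearMap.opNorm_le_bound (by positivity) fun x => ?_
  have hx : x = fun i => ‖x i‖ • (‖x i‖⁻¹ • x i) := by
    funext i
    by_cases h : x i = 0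
    · simp [h]
    · rw [smul_smul, mul_inv_cancel₀ (norm_ne_zero_iff.mpr h), one_smul]
  have h₁ := unit (fun i => ‖x i‖⁻¹ • x i) fun i => by
    rw [norm_smul, norm_inv, norm_norm]
    exact inv_mul_le_one
  conv_lhs => rw [hx]
  rw [S.map_smul_univ (fun i => ‖x i‖), norm_smul, norm_prod, mul_comm]
  simp only [norm_norm]
  gcongr

/-- `v` is the sum of a series of signed diagonal tensors whose total cost is at most `c`. -/
def IsDiagonalSeries {k : ℕ} {E X : Type*} [NormedAddCommGroup E] [NormedSpace ℝ E]
    [NormedAddCommGroup X] [NormedSpace ℝ X]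
    (ι : ContinuousMultilinearMap ℝ (fun _ : Fin k => E) X) (c : ℝ) (v : X) : Prop :=
  ∃ (x : ℕ → E) (ε : ℕ → ℝ), (∀ i, ε i = 1 ∨ ε i = -1) ∧ Summable (fun i => ‖x i‖ ^ k) ∧
    ∑' i, ‖x i‖ ^ k ≤ c ∧ HasSum (fun i => ε i • ι (fun _ => x i)) v

namespace IsDiagonalSeries

variable {k : ℕ} {E X : Type*} [NormedAddCommGroup E] [NormedSpace ℝ E]
  [NormedAddCommGroup X] [NormedSpace ℝ X]
  {ι : ContinuousMultilinearMap ℝ (fun _ : Fin k => E) X}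

lemma mem_symTensor {c : ℝ} {v : X} (h : IsDiagonalSeries ι c v) : v ∈ symTensor ι := by
  obtain ⟨x, ε, -, -, -, hv⟩ := h
  refine (Submodule.isClosed_topologicalClosure _).mem_of_tendsto hv (.of_forall fun s => ?_)
  exact Submodule.le_topologicalClosure _ <| Submodule.sum_mem _ fun i _ =>
    Submodule.smul_mem _ _ (Submodule.subset_span ⟨_, rfl⟩)

lemma of_denumerable {β : Type*} [Denumerable β] {x : β → E} {ε : β → ℝ} {c : ℝ} {v : X}
    (hε : ∀ i, ε i = 1 ∨ ε i = -1) (hx : Summable fun i => ‖x i‖ ^ k)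
    (hc : ∑' i, ‖x i‖ ^ k ≤ c) (hv : HasSum (fun i => ε i • ι (fun _ => x i)) v) :
    IsDiagonalSeries ι c v := by
  let e : ℕ ≃ β := (Denumerable.eqv β).symm
  refine ⟨fun i => x (e i), fun i => ε (e i), fun i => hε _,
    (e.summable_iff (f := fun i => ‖x i‖ ^ k)).mpr hx, ?_,
    (e.hasSum_iff (f := fun i => ε i • ι (fun _ => x i))).mpr hv⟩
  exact (e.tsum_eq fun i => ‖x i‖ ^ k).trans_le hc

lemma single (hk : 0 < k) {ε : ℝ} (hε : ε = 1 ∨ ε = -1) (y : E) :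
    IsDiagonalSeries ι (‖y‖ ^ k) (ε • ι fun _ => y) := by
  have : Nonempty (Fin k) := ⟨⟨0, hk⟩⟩
  have h₀ : ι (fun _ => (0 : E)) = 0 := ι.map_zero
  have hs : HasSum (fun i : ℕ => ‖(Pi.single 0 y : ℕ → E) i‖ ^ k) (‖y‖ ^ k) := by
    convert hasSum_single (f := fun i : ℕ => ‖(Pi.single 0 y : ℕ → E) i‖ ^ k) 0 ?_ using 1
    · simp
    · intro i hi
      simp [Pi.single_eq_of_ne hi, hk.ne']
  refine ⟨Pi.single 0 y, fun _ => ε, fun _ => hε, hs.summable, hs.tsum_eq.le, ?_⟩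
  convert hasSum_single (f := fun i : ℕ => ε • ι fun _ => (Pi.single 0 y : ℕ → E) i) 0 ?_ using 1
  · simp
  · intro i hi
    simp [Pi.single_eq_of_ne hi, h₀]

lemma smul (hk : 0 < k) {c t : ℝ} {v : X} (ht : 0 ≤ t) (h : IsDiagonalSeries ι c v) :
    IsDiagonalSeries ι (t * c) (t • v) := by
  obtain ⟨x, ε, hε, hx, hc, hv⟩ := h
  obtain ⟨s, hs, rfl⟩ : ∃ s : ℝ, 0 ≤ s ∧ s ^ k = t :=
    ⟨t ^ (k⁻¹ : ℝ), by positivity, Real.rpow_inv_natCast_pow ht hk.ne'⟩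
  have hnorm : (fun i => ‖s • x i‖ ^ k) = fun i => s ^ k * ‖x i‖ ^ k := by
    funext i
    rw [norm_smul, mul_pow, Real.norm_of_nonneg hs]
  refine ⟨fun i => s • x i, ε, hε, ?_, ?_, ?_⟩
  · rw [hnorm]
    exact hx.mul_left _
  · rw [hnorm, tsum_mul_left]
    gcongr
  · convert hv.const_smul (s ^ k) using 2 with i
    rw [ι.map_smul_univ (fun _ => s) (fun _ => x i), smul_comm]
    simp

lemma add {c d : ℝ} {v w : X} (hv : IsDiagonalSeries ι c v) (hw : IsDiagonalSeries ι d w) :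
    IsDiagonalSeries ι (c + d) (v + w) := by
  obtain ⟨x, ε, hε, hx, hc, hv⟩ := hv
  obtain ⟨y, η, hη, hy, hd, hw⟩ := hw
  have hs : HasSum (fun i => ‖Sum.elim x y i‖ ^ k) (∑' i, ‖x i‖ ^ k + ∑' i, ‖y i‖ ^ k) :=
    HasSum.sum hx.hasSum hy.hasSum
  refine of_denumerable (x := Sum.elim x y) (ε := Sum.elim ε η) ?_ hs.summable ?_ ?_
  · rintro (i | i)
    exacts [hε i, hη i]
  · rw [hs.tsum_eq]
    gcongr
  · exact HasSum.sum hv hw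

lemma hasSum [CompleteSpace X] (hι : ∀ x, ‖ι x‖ ≤ ∏ i, ‖x i‖) {c : ℕ → ℝ} {v : ℕ → X} {w : X}
    (h : ∀ n, IsDiagonalSeries ι (c n) (v n)) (hc : Summable c) (hv : HasSum v w) :
    IsDiagonalSeries ι (∑' n, c n) w := by
  choose x ε hε hx hxc hxv using h
  have hrow : Summable fun n => ∑' i, ‖x n i‖ ^ k :=
    Summable.of_nonneg_of_le (fun n => tsum_nonneg fun i => by positivity) hxc hc
  have hs : Summable fun p : ℕ × ℕ => ‖x p.1 p.2‖ ^ k :=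
    (summable_prod_of_nonneg fun p => by positivity).mpr ⟨hx, hrow⟩
  have hsv : Summable fun p : ℕ × ℕ => ε p.1 p.2 • ι (fun _ => x p.1 p.2) := by
    refine Summable.of_norm_bounded hs fun p => ?_
    have : ‖ε p.1 p.2‖ = 1 := by rcases hε p.1 p.2 with h | h <;> simp [h]
    rw [norm_smul, this, one_mul]
    simpa using hι fun _ => x p.1 p.2
  refine of_denumerable (x := fun p : ℕ × ℕ => x p.1 p.2) (ε := fun p => ε p.1 p.2)
    (fun p => hε _ _) hs ?_ ?_
  · rw [hs.tsum_prod' hx]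
    exact hrow.tsum_le_tsum hxc hc
  · rw [← (hsv.hasSum.prod_fiberwise hxv).unique hv]
    exact hsv.hasSum

lemma convex (hk : 0 < k) (c : ℝ) : Convex ℝ {v | IsDiagonalSeries ι c v} := by
  intro v hv w hw a b ha hb hab
  have := (hv.smul hk ha).add (hw.smul hk hb)
  rwa [← add_mul, hab, one_mul] at this

end IsDiagonalSeries

/-- A functional that is bounded by `M` on the diagonal tensors is bounded by `k ^ k / k ! * M`
on the symmetric tensor product. -/
lemma IsProjTensorProductPi.apply_le_of_diagonal_le {k : ℕ} {E X : Type*}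
    [NormedAddCommGroup E] [NormedSpace ℝ E]
    [NormedAddCommGroup X] [NormedSpace ℝ X] [CompleteSpace X]
    {ι : ContinuousMultilinearMap ℝ (fun _ : Fin k => E) X}
    (hX : IsProjTensorProductPi (fun _ : Fin k => E) X ι) (f : X →L[ℝ] ℝ) {M : ℝ} (hM : 0 ≤ M)
    (hf : ∀ y : E, |f (ι fun _ => y)| ≤ M * ‖y‖ ^ k) {w : X} (hw : w ∈ symTensor ι) :
    f w ≤ (k : ℝ) ^ k / (Nat.factorial k : ℝ) * M * ‖w‖ := by
  set g := f.compContinuousMultilinearMap ι with hg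
  set S := ∑ σ : Equiv.Perm (Fin k), g.domDomCongr σ with hS
  have hSn : ‖S‖ ≤ (k : ℝ) ^ k * M := norm_symmetrization_le g hM hf
  obtain ⟨T, hT, hTι⟩ := hX.lift (ULift ℝ)
    ((LinearIsometryEquiv.ulift ℝ ℝ).symm.toContinuousLinearEquiv.toContinuousLinearMap
      |>.compContinuousMultilinearMap S)
  have hTn : ‖T‖ ≤ (k : ℝ) ^ k * M := by
    refine hT.trans (le_trans ?_ hSn)
    refine ContinuousMultilinearMap.opNorm_le_bound (norm_nonneg _) fun x => ?_
    exact S.le_opNorm x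
  have heq : (T w).down = (Nat.factorial k : ℝ) * f w := by
    have hclosed : IsClosed {w : X | (T w).down = (Nat.factorial k : ℝ) * f w} :=
      isClosed_eq (continuous_uliftDown.comp T.continuous) (by fun_prop)
    refine closure_minimal (fun z hz => ?_) hclosed hw
    induction hz using Submodule.span_induction with
    | mem z hz =>
      obtain ⟨y, rfl⟩ := hz
      have : S (fun _ => y) = (Nat.factorial k : ℝ) * f (ι fun _ => y) := by
        simp [hS, hg, Fintype.card_perm]
      rw [Set.mem_ofPred_eq, hTι]
      exact this
    | zero => simp
    | add a b _ _ ha hb =>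
      simp only [Set.mem_ofPred_eq] at ha hb ⊢
      rw [map_add, ULift.add_down, ha, hb, map_add, mul_add]
    | smul t a _ ha =>
      simp only [Set.mem_ofPred_eq] at ha ⊢
      rw [map_smul, ULift.smul_down, ha, map_smul, smul_eq_mul, smul_eq_mul]
      ring
  have hle : (Nat.factorial k : ℝ) * f w ≤ (k : ℝ) ^ k * M * ‖w‖ := by
    rw [← heq]
    refine (le_abs_self _).trans ((T.le_opNorm w).trans ?_)
    gcongr
  have hpos : (0 : ℝ) < Nat.factorial k := by exact_mod_cast Nat.factorial_pos k
  rw [div_mul_eq_mul_div, div_mul_eq_mul_div, le_div_iff₀ hpos, mul_comm]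
  exact hle

/-- The symmetric tensors of norm at most `b` are limits of diagonal series of cost at most
`k ^ k / k ! * b`. -/
lemma IsProjTensorProductPi.mem_closure_isDiagonalSeries {k : ℕ} (hk : 0 < k) {E X : Type*}
    [NormedAddCommGroup E] [NormedSpace ℝ E]
    [NormedAddCommGroup X] [NormedSpace ℝ X] [CompleteSpace X]
    {ι : ContinuousMultilinearMap ℝ (fun _ : Fin k => E) X}
    (hX : IsProjTensorProductPi (fun _ : Fin k => E) X ι) {w : X} (hw : w ∈ symTensor ι)
    {b : ℝ} (hb : 0 < b) (hwb : ‖w‖ ≤ b) :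
    w ∈ closure {v | IsDiagonalSeries ι ((k : ℝ) ^ k / (Nat.factorial k : ℝ) * b) v} := by
  have : Nonempty (Fin k) := ⟨⟨0, hk⟩⟩
  set C : ℝ := (k : ℝ) ^ k / (Nat.factorial k : ℝ)
  have hk' : (0 : ℝ) < k := by exact_mod_cast hk
  have hCpos : 0 < C := div_pos (by positivity) (by exact_mod_cast Nat.factorial_pos k)
  have hc : 0 < C * b := mul_pos hCpos hb
  by_contra hcon
  obtain ⟨f, s, hfs, hsw⟩ := geometric_hahn_banach_closed_point
    (IsDiagonalSeries.convex hk (C * b)).closure isClosed_closure hcon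
  have hdiag : ∀ y : E, ∀ ε : ℝ, ε = 1 ∨ ε = -1 → y ≠ 0 →
      C * b / ‖y‖ ^ k * (ε * f (ι fun _ => y)) < s := by
    intro y ε hε hy
    have hy' : 0 < ‖y‖ := norm_pos_iff.mpr hy
    have h := (IsDiagonalSeries.single (ι := ι) hk hε y).smul hk
      (t := C * b / ‖y‖ ^ k) (by positivity)
    rw [div_mul_cancel₀ _ (by positivity)] at h
    simpa using hfs _ (subset_closure h)
  have hs : 0 ≤ s := by
    have h₀ : ι (fun _ => (0 : E)) = 0 := ι.map_zero
    refine le_trans ?_ (hfs 0 (subset_closure ?_)).le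
    · simp
    · refine ⟨0, 1, fun _ => Or.inl rfl, ?_, ?_, ?_⟩ <;>
        simp [hk.ne', h₀, hc.le, summable_zero, hasSum_zero]
  have hbound : ∀ y : E, |f (ι fun _ => y)| ≤ s / (C * b) * ‖y‖ ^ k := by
    intro y
    rcases eq_or_ne y 0 with rfl | hy
    · have h₀ : ι (fun _ => (0 : E)) = 0 := ι.map_zero
      simp [h₀, hk.ne']
    have hy' : 0 < ‖y‖ ^ k := pow_pos (norm_pos_iff.mpr hy) k
    have h₁ := hdiag y 1 (Or.inl rfl) hy
    have h₂ := hdiag y (-1) (Or.inr rfl) hy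
    rw [div_mul_eq_mul_div, div_lt_iff₀ hy'] at h₁ h₂
    rw [div_mul_eq_mul_div, le_div_iff₀ hc, ← abs_of_pos hc, ← abs_mul, abs_le]
    constructor <;> linarith
  have h := hX.apply_le_of_diagonal_le f (div_nonneg hs hc.le) hbound hw
  have h' : C * (s / (C * b)) * ‖w‖ ≤ s := by
    calc C * (s / (C * b)) * ‖w‖ ≤ C * (s / (C * b)) * b := by gcongr
      _ = s := by field_simp
  linarith

/-- Every element of the k-fold symmetric projective tensor product of E is, for every δ > 0,
the sum of a series Σᵢ εᵢ xᵢ ⊗ ⋯ ⊗ xᵢ with signs εᵢ and Σᵢ ‖xᵢ‖ᵏ ≤ (kᵏ/k!)(‖u‖ + δ). -/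
theorem symTensor_diagonal_representation
    (E : Type*) [NormedAddCommGroup E] [NormedSpace ℝ E] [CompleteSpace E]
    (k : ℕ) (hk : 0 < k)
    (X : Type*) [NormedAddCommGroup X] [NormedSpace ℝ X] [CompleteSpace X]
    (ι : ContinuousMultilinearMap ℝ (fun _ : Fin k => E) X)
    (hX : IsProjTensorProductPi (fun _ : Fin k => E) X ι)
    (u : X) (hu : u ∈ symTensor ι) (δ : ℝ) (hδ : 0 < δ) :
    ∃ (x : ℕ → E) (ε : ℕ → ℝ), (∀ i, ε i = 1 ∨ ε i = -1) ∧
      Summable (fun i => ‖x i‖ ^ k) ∧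
      (∑' i, ‖x i‖ ^ k) ≤ ((k : ℝ) ^ k / (Nat.factorial k : ℝ)) * (‖u‖ + δ) ∧
      Filter.Tendsto (fun N => ∑ i ∈ Finset.range N, ε i • ι (fun _ => x i))
        Filter.atTop (nhds u) := by
  set C : ℝ := (k : ℝ) ^ k / (Nat.factorial k : ℝ)
  let b : ℕ → ℝ := fun n => Nat.casesOn n (‖u‖ + δ / 2) fun m => δ / 2 / 2 / 2 ^ m
  have hb_sum : HasSum b (‖u‖ + δ) := by
    have h := (hasSum_geometric_two' (δ / 2)).zero_add (f := b)
    convert h using 1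
    change ‖u‖ + δ = ‖u‖ + δ / 2 + δ / 2
    ring
  have hb_pos : ∀ n, 0 < b n := by
    rintro (_ | n)
    · change 0 < ‖u‖ + δ / 2
      positivity
    · change 0 < δ / 2 / 2 / 2 ^ n
      positivity
  have step : ∀ n, ∀ w : {w : X // w ∈ symTensor ι ∧ ‖w‖ ≤ b n},
      ∃ w' : {w : X // w ∈ symTensor ι ∧ ‖w‖ ≤ b (n + 1)},
        IsDiagonalSeries ι (C * b n) (w - w') := by
    rintro n ⟨w, hw, hwb⟩
    obtain ⟨v, hv, hvw⟩ := Metric.mem_closure_iff.mp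
      (hX.mem_closure_isDiagonalSeries hk hw (hb_pos n) hwb) _ (hb_pos (n + 1))
    refine ⟨⟨w - v, Submodule.sub_mem _ hw hv.mem_symTensor, ?_⟩, ?_⟩
    · rw [← dist_eq_norm]
      exact hvw.le
    · simpa using hv
  choose next hnext using step
  let r : ∀ n, {w : X // w ∈ symTensor ι ∧ ‖w‖ ≤ b n} :=
    Nat.rec ⟨u, hu, by change ‖u‖ ≤ ‖u‖ + δ / 2; linarith⟩ next
  have hr : ∀ n, IsDiagonalSeries ι (C * b n) ((r n).1 - (r (n + 1)).1) := fun n =>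
    hnext n (r n)
  have hr_zero : Tendsto (fun n => (r n).1) atTop (𝓝 0) :=
    squeeze_zero_norm (fun n => (r n).2.2) hb_sum.summable.tendsto_atTop_zero
  have hsummable : Summable fun n => (r n).1 - (r (n + 1)).1 := by
    refine Summable.of_norm_bounded
      (hb_sum.summable.add ((summable_nat_add_iff 1).mpr hb_sum.summable)) fun n => ?_
    exact (norm_sub_le _ _).trans (add_le_add (r n).2.2 (r (n + 1)).2.2)
  have hsum : HasSum (fun n => (r n).1 - (r (n + 1)).1) u := by
    rw [hsummable.hasSum_iff_tendsto_nat]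
    simp_rw [Finset.sum_range_sub']
    change Tendsto (fun n => u - (r n).1) atTop (𝓝 u)
    simpa using tendsto_const_nhds (x := u).sub hr_zero
  obtain ⟨x, ε, hε, hx, hc, hxu⟩ :=
    IsDiagonalSeries.hasSum hX.norm_le hr (hb_sum.summable.mul_left C) hsum
  refine ⟨x, ε, hε, hx, ?_, hxu.tendsto_sum_nat⟩
  rwa [tsum_mul_left, hb_sum.tsum_eq] at hc
end
end

section
/- Let E be a Banach space and k > 1 an integer. Every continuous k-homogeneous polynomial from E into c₀ is weakly compact if and only if the Banach space P(ᵏE) of all continuous scalar-valued k-homogeneous polynomials on E (with the supremum norm over the unit ball) is reflexive. -/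
open Filter Topology NormedSpace ZeroAtInfty

noncomputable section

/-- A set is relatively weakly compact if its closure in the weak topology is compact. -/
def RelWeaklyCompact {F : Type*} [NormedAddCommGroup F] [NormedSpace ℝ F] (s : Set F) : Prop :=
  IsCompact (closure (toWeakSpace ℝ F '' s))

/-- A map is weakly compact if it sends bounded sets to relatively weakly compact sets. -/
def WeaklyCompactMap {E F : Type*} [NormedAddCommGroup E] [NormedSpace ℝ E]
    [NormedAddCommGroup F] [NormedSpace ℝ F] (P : E → F) : Prop :=
  ∀ s : Set E, Bornology.IsBounded s → RelWeaklyCompact (P '' s)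

/-- A continuous `k`-homogeneous polynomial is a map of the form `x ↦ A (x, …, x)` for
a continuous `k`-linear map `A`. -/
def IsHomogPoly {E F : Type*} [NormedAddCommGroup E] [NormedSpace ℝ E]
    [NormedAddCommGroup F] [NormedSpace ℝ F] (k : ℕ) (P : E → F) : Prop :=
  ∃ A : ContinuousMultilinearMap ℝ (fun _ : Fin k => E) F, ∀ x, P x = A (fun _ => x)

variable (k : ℕ) (E : Type*) [NormedAddCommGroup E] [NormedSpace ℝ E]

/-- The vector space `P(ᵏE)` of continuous scalar-valued `k`-homogeneous polynomials on `E`. -/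
def homogPolySp : Submodule ℝ (E → ℝ) where
  carrier := {P | IsHomogPoly k P}
  add_mem' := by
    rintro P Q ⟨A, hA⟩ ⟨B, hB⟩
    exact ⟨A + B, fun x => by simp [hA x, hB x]⟩
  zero_mem' := ⟨0, fun x => by simp⟩
  smul_mem' := by
    rintro c P ⟨A, hA⟩
    exact ⟨c • A, fun x => by simp [hA x]⟩

theorem homogPoly_continuous {k : ℕ} {E : Type*} [NormedAddCommGroup E] [NormedSpace ℝ E]
    {P : E → ℝ} (h : IsHomogPoly k P) : Continuous P := by
  obtain ⟨A, hA⟩ := h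
  have : P = fun x => A (fun _ => x) := funext hA
  rw [this]
  exact A.cont.comp (continuous_pi fun _ => continuous_id)

theorem homogPoly_bound {k : ℕ} {E : Type*} [NormedAddCommGroup E] [NormedSpace ℝ E]
    {P : E → ℝ} (h : IsHomogPoly k P) :
    ∃ C : ℝ, ∀ x : Metric.closedBall (0 : E) 1, ‖P x.1‖ ≤ C := by
  obtain ⟨A, hA⟩ := h
  refine ⟨‖A‖, fun x => ?_⟩
  rw [hA x.1]
  calc ‖A (fun _ => x.1)‖ ≤ ‖A‖ * ∏ _i : Fin k, ‖x.1‖ := A.le_opNorm _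
    _ ≤ ‖A‖ * 1 := by
        refine mul_le_mul_of_nonneg_left ?_ (norm_nonneg A)
        exact Finset.prod_le_one (fun i _ => norm_nonneg _)
            (fun i _ => by
              have := x.2
              rwa [Metric.mem_closedBall, dist_zero_right] at this)
    _ = ‖A‖ := mul_one _

/-- Restriction of a homogeneous polynomial to the closed unit ball, as a bounded
continuous function. -/
def homogPolyRestrict :
    homogPolySp k E →ₗ[ℝ] BoundedContinuousFunction (Metric.closedBall (0 : E) 1) ℝ where
  toFun P :=
    BoundedContinuousFunction.ofNormedAddCommGroup (fun x => P.1 x.1)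
      ((homogPoly_continuous P.2).comp continuous_subtype_val)
      (homogPoly_bound P.2).choose (homogPoly_bound P.2).choose_spec
  map_add' P Q := by ext x; rfl
  map_smul' c P := by ext x; rfl

theorem homogPolyRestrict_injective : Function.Injective (homogPolyRestrict k E) := by
  intro P Q hPQ
  have h : ∀ x : Metric.closedBall (0 : E) 1, P.1 x.1 = Q.1 x.1 := by
    intro x
    have := congrArg (fun f => f x) hPQ
    simpa [homogPolyRestrict, BoundedContinuousFunction.ofNormedAddCommGroup] using this
  have key : ∀ (R : homogPolySp k E), (∀ x : Metric.closedBall (0 : E) 1, R.1 x.1 = 0) →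
      ∀ y : E, R.1 y = 0 := by
    rintro ⟨R, A, hA⟩ hball y
    rcases eq_or_ne y 0 with rfl | hy
    · exact hball ⟨0, by simp⟩
    · have hpos : (0:ℝ) < ‖y‖ := norm_pos_iff.mpr hy
      have hz : ‖y‖⁻¹ • y ∈ Metric.closedBall (0 : E) 1 := by
        rw [Metric.mem_closedBall, dist_zero_right, norm_smul, norm_inv, norm_norm]
        exact le_of_eq (inv_mul_cancel₀ (ne_of_gt hpos))
      have h1 : R (‖y‖⁻¹ • y) = 0 := hball ⟨_, hz⟩
      have h2 : A (fun _ : Fin k => (‖y‖⁻¹ : ℝ) • y) =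
          (∏ _i : Fin k, (‖y‖⁻¹ : ℝ)) • A (fun _ => y) := by
        simpa using A.map_smul_univ (fun _ : Fin k => (‖y‖⁻¹ : ℝ)) (fun _ => y)
      have h3 : R y = A (fun _ => y) := hA y
      rw [hA _, h2] at h1
      have hprod : (∏ _i : Fin k, (‖y‖⁻¹ : ℝ)) ≠ 0 := by
        apply Finset.prod_ne_zero_iff.mpr
        intro i _
        exact inv_ne_zero (ne_of_gt hpos)
      rw [smul_eq_mul] at h1
      rcases mul_eq_zero.mp h1 with hc | hc
      · exact absurd hc hprod
      · show R y = 0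
        rw [h3, hc]
  have : ∀ y : E, P.1 y = Q.1 y := by
    have hd : ∀ x : Metric.closedBall (0 : E) 1, (P - Q).1 x.1 = 0 := by
      intro x
      have : (P - Q).1 x.1 = P.1 x.1 - Q.1 x.1 := rfl
      rw [this, h x, sub_self]
    intro y
    have := key (P - Q) hd y
    have h' : P.1 y - Q.1 y = 0 := this
    linarith
  exact Subtype.ext (funext this)

/-- `P(ᵏE)` with the supremum norm over the closed unit ball. -/
instance : NormedAddCommGroup (homogPolySp k E) :=
  NormedAddCommGroup.induced _ _ (homogPolyRestrict k E) (homogPolyRestrict_injective k E)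

instance : NormedSpace ℝ (homogPolySp k E) :=
  NormedSpace.induced ℝ _ _ (homogPolyRestrict k E)

section Polarization

variable {E F : Type*} [NormedAddCommGroup E] [NormedSpace ℝ E]
  [NormedAddCommGroup F] [NormedSpace ℝ F]

/-- The polarization of a map `R`, which recovers the symmetric `k`-linear map of a
`k`-homogeneous polynomial. -/
def polarization (k : ℕ) (R : E → F) (v : Fin k → E) : F :=
  (k.factorial : ℝ)⁻¹ • ∑ s : Finset (Fin k), ((-1 : ℝ) ^ s.card) • R (∑ i ∈ sᶜ, v i)

theorem sum_neg_one_pow_smul_map_sum_compl {k : ℕ}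
    (A : MultilinearMap ℝ (fun _ : Fin k => E) F) (v : Fin k → E) :
    ∑ s : Finset (Fin k), ((-1 : ℝ) ^ s.card) • A (fun _ => ∑ i ∈ sᶜ, v i) =
      ∑ σ : Equiv.Perm (Fin k), A (fun i => v (σ i)) := by
  classical
  have h1 : ∀ s : Finset (Fin k), ((-1 : ℝ) ^ s.card) • A (fun _ => ∑ i ∈ sᶜ, v i) =
      ∑ r : Fin k → Fin k, if s ⊆ (Finset.univ.image r)ᶜ then
        ((-1 : ℝ) ^ s.card) • A (fun i => v (r i)) else 0 := by
    intro s
    have h := A.map_sum_finset (fun _ j => v j) (fun _ => sᶜ)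
    rw [h, Finset.smul_sum, ← Finset.sum_filter]
    refine Finset.sum_congr ?_ fun _ _ => rfl
    ext r
    simp only [Fintype.mem_piFinset, Finset.mem_compl, Finset.mem_filter, Finset.mem_univ,
      true_and, Finset.subset_iff, Finset.mem_image, not_exists]
    exact ⟨fun hr i hi j hj => hr j (hj ▸ hi), fun hr i hi => hr hi i rfl⟩
  simp_rw [h1]
  rw [Finset.sum_comm]
  have h2 : ∀ r : Fin k → Fin k, (∑ s : Finset (Fin k), if s ⊆ (Finset.univ.image r)ᶜ then
        ((-1 : ℝ) ^ s.card) • A (fun i => v (r i)) else 0) =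
      if Function.Bijective r then A (fun i => v (r i)) else 0 := by
    intro r
    rw [← Finset.sum_filter, ← Finset.sum_smul]
    have h3 : (Finset.univ.filter fun s : Finset (Fin k) => s ⊆ (Finset.univ.image r)ᶜ) =
        ((Finset.univ.image r)ᶜ).powerset := by ext s; simp
    have h4 := @Finset.sum_powerset_neg_one_pow_card (Fin k) _ ((Finset.univ.image r)ᶜ)
    have h5 : ∑ s ∈ ((Finset.univ.image r)ᶜ).powerset, (-1 : ℝ) ^ s.card =
        if (Finset.univ.image r)ᶜ = ∅ then 1 else 0 := by
      exact_mod_cast congrArg (fun z : ℤ => (z : ℝ)) h4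
    rw [h3, h5]
    have h6 : (Finset.univ.image r)ᶜ = ∅ ↔ Function.Bijective r := by
      rw [Finset.compl_eq_empty_iff, ← Finite.surjective_iff_bijective, ← Finset.coe_inj]
      simp [Set.range_eq_univ]
    simp [h6]
  simp_rw [h2]
  rw [← Finset.sum_filter]
  symm
  refine Finset.sum_bij (fun σ _ => (σ : Fin k → Fin k)) ?_ ?_ ?_ ?_
  · intro σ _; exact Finset.mem_filter.mpr ⟨Finset.mem_univ _, σ.bijective⟩
  · intro σ _ τ _ h; exact DFunLike.coe_injective h
  · intro r hr
    exact ⟨Equiv.ofBijective r (Finset.mem_filter.mp hr).2, Finset.mem_univ _, rfl⟩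
  · intro σ _; rfl

theorem IsHomogPoly.exists_multilinear_polarization {k : ℕ} {R : E → F} (h : IsHomogPoly k R) :
    ∃ M : MultilinearMap ℝ (fun _ : Fin k => E) F,
      (∀ v, polarization k R v = M v) ∧ ∀ x, R x = M (fun _ => x) := by
  obtain ⟨A, hA⟩ := h
  have hf : (k.factorial : ℝ) ≠ 0 := by exact_mod_cast k.factorial_ne_zero
  refine ⟨(k.factorial : ℝ)⁻¹ • ∑ σ : Equiv.Perm (Fin k), A.toMultilinearMap.domDomCongr σ,
    fun v => ?_, fun x => ?_⟩
  · have := sum_neg_one_pow_smul_map_sum_compl A.toMultilinearMap v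
    simp only [polarization, hA]
    simpa using congrArg (fun z => (k.factorial : ℝ)⁻¹ • z) this
  · simp [hA, Fintype.card_perm, ← Nat.cast_smul_eq_nsmul ℝ, smul_smul, hf]

theorem IsHomogPoly.exists_bound {k : ℕ} {R : E → F} (h : IsHomogPoly k R) :
    ∃ C, 0 ≤ C ∧ ∀ x, ‖R x‖ ≤ C * ‖x‖ ^ k := by
  obtain ⟨A, hA⟩ := h
  exact ⟨‖A‖, norm_nonneg _, fun x => by simpa [hA] using A.le_opNorm (fun _ => x)⟩

theorem norm_polarization_le {k : ℕ} {R : E → F} {C : ℝ} (hC : 0 ≤ C)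
    (hR : ∀ x, ‖R x‖ ≤ C * ‖x‖ ^ k) (v : Fin k → E) (hv : ∀ i, ‖v i‖ ≤ 1) :
    ‖polarization k R v‖ ≤ (k.factorial : ℝ)⁻¹ * (2 ^ k * (C * k ^ k)) := by
  rw [polarization, norm_smul, norm_inv, RCLike.norm_natCast]
  gcongr
  refine (norm_sum_le _ _).trans ((Finset.sum_le_card_nsmul _ _ (C * k ^ k) ?_).trans ?_)
  · intro s _
    rw [norm_smul, norm_pow, norm_neg, norm_one, one_pow, one_mul]
    refine (hR _).trans ?_
    gcongr
    refine (norm_sum_le _ _).trans ((Finset.sum_le_card_nsmul _ _ 1 fun i _ => hv i).trans ?_)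
    simpa using (Finset.card_le_univ sᶜ)
  · simp

theorem MultilinearMap.norm_le_of_norm_le_on_ball {k : ℕ}
    (M : MultilinearMap ℝ (fun _ : Fin k => E) F) {C : ℝ}
    (h : ∀ v : Fin k → E, (∀ i, ‖v i‖ ≤ 1) → ‖M v‖ ≤ C) (v : Fin k → E) :
    ‖M v‖ ≤ C * ∏ i, ‖v i‖ := by
  have h1 : M v = (∏ i, ‖v i‖) • M (fun i => ‖v i‖⁻¹ • v i) := by
    rw [← M.map_smul_univ]
    congr 1
    ext i
    rcases eq_or_ne (v i) 0 with hi | hi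
    · simp [hi]
    · simp [smul_smul, norm_ne_zero_iff.mpr hi]
  rw [h1, norm_smul, mul_comm, Real.norm_of_nonneg (Finset.prod_nonneg fun i _ => norm_nonneg _)]
  gcongr
  refine h _ fun i => ?_
  rw [norm_smul, norm_inv, norm_norm]
  exact inv_mul_le_one

/-- A bounded map is a homogeneous polynomial as soon as its compositions with a separating
family of linear functionals are. -/
theorem isHomogPoly_of_separating {k : ℕ} {ι : Type*} (L : ι → F →ₗ[ℝ] ℝ)
    (hL : ∀ a b : F, (∀ i, L i a = L i b) → a = b) {R : E → F}
    (hR : ∀ i, IsHomogPoly k (fun x => L i (R x)))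
    {C : ℝ} (hC : 0 ≤ C) (hb : ∀ x, ‖R x‖ ≤ C * ‖x‖ ^ k) : IsHomogPoly k R := by
  choose M hM hMd using fun i => (hR i).exists_multilinear_polarization
  have hp : ∀ i v, L i (polarization k R v) = M i v := by
    intro i v
    rw [← hM]
    simp [polarization, map_sum]
  let N : MultilinearMap ℝ (fun _ : Fin k => E) F :=
    { toFun := polarization k R
      map_update_add' := by
        intro _ v i x y
        refine hL _ _ fun j => ?_
        rw [map_add, hp, hp, hp]
        convert (M j).map_update_add v i x y
      map_update_smul' := by
        intro _ v i c x
        refine hL _ _ fun j => ?_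
        rw [map_smul, hp, hp]
        convert (M j).map_update_smul v i c x }
  have hN : ∀ v, N v = polarization k R v := fun _ => rfl
  refine ⟨N.mkContinuous _ (MultilinearMap.norm_le_of_norm_le_on_ball N
    fun v hv => norm_polarization_le hC hb v hv), fun x => ?_⟩
  refine hL _ _ fun j => ?_
  rw [MultilinearMap.coe_mkContinuous, hN, hp, ← hMd]

theorem IsHomogPoly.clm_comp {G : Type*} [NormedAddCommGroup G] [NormedSpace ℝ G] {k : ℕ}
    {R : E → F} (h : IsHomogPoly k R) (L : F →L[ℝ] G) : IsHomogPoly k (fun x => L (R x)) := by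
  obtain ⟨A, hA⟩ := h
  exact ⟨L.compContinuousMultilinearMap A, fun x => by simp [hA]⟩

theorem IsHomogPoly.comp_clm {G : Type*} [NormedAddCommGroup G] [NormedSpace ℝ G] {k : ℕ}
    {R : E → F} (h : IsHomogPoly k R) (L : G →L[ℝ] E) : IsHomogPoly k (fun x => R (L x)) := by
  obtain ⟨A, hA⟩ := h
  exact ⟨A.compContinuousLinearMap fun _ => L, fun x => by simp [hA]⟩

theorem IsHomogPoly.clm_mul {k : ℕ} {R : E → ℝ} (h : IsHomogPoly k R) (f : StrongDual ℝ E) :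
    IsHomogPoly (k + 1) (fun x => f x * R x) := by
  obtain ⟨A, hA⟩ := h
  refine ⟨ContinuousLinearMap.uncurryLeft (f.smulRight A), fun x => ?_⟩
  simp only [ContinuousLinearMap.uncurryLeft_apply]
  rw [hA]
  simp
  left
  rfl

theorem isHomogPoly_pow (k : ℕ) (f : StrongDual ℝ E) : IsHomogPoly k (fun x => f x ^ k) := by
  induction k with
  | zero => exact ⟨ContinuousMultilinearMap.constOfIsEmpty ℝ _ 1, fun x => by simp⟩
  | succ k ih => simpa [pow_succ'] using ih.clm_mul f

end Polarization

section Duality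

variable {W : Type*} [NormedAddCommGroup W] [NormedSpace ℝ W]

/-- A functional dominated by the support function of a convex set `U` of functionals lies in the
weak-star closure of `U`. -/
theorem exists_mem_forall_abs_sub_lt {U : Set (StrongDual ℝ W)} (hU : Convex ℝ U)
    (η : StrongDual ℝ W) (h : ∀ w c, (∀ u ∈ U, u w ≤ c) → η w ≤ c)
    (s : Finset W) {ε : ℝ} (hε : 0 < ε) : ∃ u ∈ U, ∀ w ∈ s, |u w - η w| < ε := by
  classical
  let T : StrongDual ℝ W →ₗ[ℝ] (s → ℝ) :=
    LinearMap.pi fun w => (ContinuousLinearMap.apply ℝ ℝ (w : W)).toLinearMap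
  have hT : ∀ u w, T u w = u w := fun _ _ => rfl
  by_cases hmem : T η ∈ closure (T '' U)
  · obtain ⟨_, ⟨u, hu, rfl⟩, hd⟩ := Metric.mem_closure_iff.mp hmem ε hε
    refine ⟨u, hu, fun w hw => ?_⟩
    have := (dist_le_pi_dist (T η) (T u) ⟨w, hw⟩).trans_lt hd
    rwa [dist_comm, Real.dist_eq] at this
  · exfalso
    obtain ⟨f, c, hfη, hfU⟩ := geometric_hahn_banach_point_closed
      ((hU.linear_image T).closure) isClosed_closure hmem
    let a : s → ℝ := fun w => f (fun j => if w = j then 1 else 0)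
    have hf : ∀ u : StrongDual ℝ W, f (T u) = u (∑ w : s, a w • (w : W)) := by
      intro u
      have h1 := LinearMap.pi_apply_eq_sum_univ f.toLinearMap (T u)
      simp only [ContinuousLinearMap.coe_coe] at h1
      rw [h1, map_sum]
      refine Finset.sum_congr rfl fun w _ => ?_
      rw [map_smul, hT, smul_eq_mul, smul_eq_mul, mul_comm]
    have h2 := h (-∑ w : s, a w • (w : W)) (-c) fun u hu => by
      rw [map_neg, ← hf]
      exact neg_le_neg (hfU _ (subset_closure ⟨u, hu, rfl⟩)).le
    rw [map_neg, ← hf] at h2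
    linarith

theorem exists_forall_tendsto_ultrafilter {ι : Type*} (𝒰 : Ultrafilter ι) (u : ι → StrongDual ℝ W)
    {R : ℝ} (hu : ∀ n, ‖u n‖ ≤ R) :
    ∃ ζ : StrongDual ℝ W, ∀ w, Tendsto (fun n => u n w) 𝒰 (𝓝 (ζ w)) := by
  have hK := WeakDual.isCompact_closedBall (𝕜 := ℝ) (E := W) 0 R
  obtain ⟨ζ, -, hζ⟩ := hK.ultrafilter_le_nhds (𝒰.map fun n => StrongDual.toWeakDual (u n)) (by
    rw [le_principal_iff]
    refine Filter.mem_map.mpr (Filter.univ_mem' fun n => ?_)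
    simpa using hu n)
  refine ⟨WeakDual.toStrongDual ζ, fun w => ?_⟩
  exact ((WeakDual.eval_continuous w).tendsto ζ).comp hζ

theorem apply_le_of_forall_closedBall {ξ : StrongDual ℝ (StrongDual ℝ W)} {ζ : StrongDual ℝ W}
    {c : ℝ} (h : ∀ w : W, ‖w‖ ≤ ‖ξ‖ → ζ w ≤ c) : ξ ζ ≤ c := by
  have hc : 0 ≤ c := by simpa using h 0 (by rw [norm_zero]; exact norm_nonneg ξ)
  refine (le_abs_self _).trans ((ξ.le_opNorm ζ).trans ?_)
  have h1 : ‖‖ξ‖ • ζ‖ ≤ c := by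
    refine ContinuousLinearMap.opNorm_le_bound _ hc fun w => ?_
    rcases eq_or_ne w 0 with rfl | hw
    · simp
    have hw' : 0 < ‖w‖ := norm_pos_iff.mpr hw
    have h2 : ∀ v : W, ‖v‖ = ‖w‖ → ‖ξ‖ * ζ v ≤ c * ‖w‖ := by
      intro v hv
      have := h ((‖ξ‖ / ‖w‖) • v) (by
        rw [norm_smul, hv, Real.norm_of_nonneg (by positivity), div_mul_cancel₀ _ hw'.ne'])
      rw [map_smul, smul_eq_mul, div_mul_eq_mul_div, div_le_iff₀ hw'] at this
      exact this
    have h3 := h2 w rfl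
    have h4 := h2 (-w) (norm_neg w)
    rw [map_neg] at h4
    rw [smul_apply, smul_eq_mul, Real.norm_eq_abs, abs_le]
    constructor <;> linarith
  rwa [norm_smul, Real.norm_of_nonneg (norm_nonneg ξ)] at h1

/-- If some element of the bidual separates `η` from a convex set `U` of functionals having `η` in
its weak-star closure, then there is a triangular system witnessing the failure of the double limit
condition. -/
theorem exists_triangular_system {U : Set (StrongDual ℝ W)} (hU : Convex ℝ U)
    (η : StrongDual ℝ W) (h : ∀ w c, (∀ u ∈ U, u w ≤ c) → η w ≤ c)
    (ξ : StrongDual ℝ (StrongDual ℝ W)) (hξη : ξ η = 1) (hξU : ∀ u ∈ U, ξ u = 0) :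
    ∃ (p : ℕ → W) (u : ℕ → StrongDual ℝ W), (∀ n, ‖p n‖ ≤ ‖ξ‖) ∧ (∀ n, u n ∈ U) ∧
      (∀ n m, n ≤ m → 3 / 4 ≤ u m (p n)) ∧ ∀ m n, m < n → u m (p n) ≤ 1 / 8 := by
  classical
  obtain ⟨f, hf1, hf2⟩ := exists_seq_of_forall_finset_exists
    (fun a : W × StrongDual ℝ W => ‖a.1‖ ≤ ‖ξ‖ ∧ a.2 ∈ U ∧ |η a.1 - 1| < 1 / 8 ∧
      |a.2 a.1 - η a.1| < 1 / 8)
    (fun a b => |a.2 b.1| < 1 / 8 ∧ |b.2 a.1 - η a.1| < 1 / 8) (by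
      intro s hs
      obtain ⟨q, ⟨p, hp, rfl⟩, hq⟩ := exists_mem_forall_abs_sub_lt
        (U := inclusionInDoubleDual ℝ W '' Metric.closedBall 0 ‖ξ‖)
        ((convex_closedBall _ _).linear_image (inclusionInDoubleDual ℝ W).toLinearMap) ξ
        (fun ζ c hc => apply_le_of_forall_closedBall fun w hw => by
          simpa using hc _ ⟨w, by simpa using hw, rfl⟩)
        (insert η (s.image Prod.snd)) (ε := 1 / 8) (by norm_num)
      obtain ⟨u, hu, hup⟩ := exists_mem_forall_abs_sub_lt hU η h
        (insert p (s.image Prod.fst)) (ε := 1 / 8) (by norm_num)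
      refine ⟨(p, u), ⟨by simpa using hp, hu, ?_, hup p (by simp)⟩, fun a ha => ⟨?_, ?_⟩⟩
      · simpa [hξη] using hq η (by simp)
      · have := hq a.2 (by simp only [Finset.mem_insert, Finset.mem_image]; exact .inr ⟨a, ha, rfl⟩)
        simpa [hξU _ (hs a ha).2.1] using this
      · exact hup a.1 (by simp only [Finset.mem_insert, Finset.mem_image]; exact .inr ⟨a, ha, rfl⟩))
  refine ⟨fun n => (f n).1, fun n => (f n).2, fun n => (hf1 n).1, fun n => (hf1 n).2.1,
    fun n m hnm => ?_, fun m n hmn => (le_abs_self _).trans (hf2 m n hmn).1.le⟩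
  have h1 := abs_lt.mp (hf1 n).2.2.1
  have h2 : |(f m).2 (f n).1 - η (f n).1| < 1 / 8 := by
    rcases hnm.eq_or_lt with rfl | hlt
    · exact (hf1 n).2.2.2
    · exact (hf2 n m hlt).2
  have h2 := abs_lt.mp h2
  linarith [h1.1, h2.1]

end Duality

section PolynomialSpace

/-- The space `P(ᵏE)`, as a type carrying only the topology of its norm. -/
def HPoly (k : ℕ) (E : Type*) [NormedAddCommGroup E] [NormedSpace ℝ E] : Type _ := homogPolySp k E

variable {k : ℕ} {E F : Type*} [NormedAddCommGroup E] [NormedSpace ℝ E]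
  [NormedAddCommGroup F] [NormedSpace ℝ F]

instance : NormedAddCommGroup (HPoly k E) := inferInstanceAs (NormedAddCommGroup (homogPolySp k E))

instance : NormedSpace ℝ (HPoly k E) := inferInstanceAs (NormedSpace ℝ (homogPolySp k E))

instance : CoeFun (HPoly k E) fun _ => E → ℝ := ⟨fun P => Subtype.val P⟩

theorem IsHomogPoly.map_smul {R : E → F} (h : IsHomogPoly k R) (c : ℝ) (x : E) :
    R (c • x) = c ^ k • R x := by
  obtain ⟨A, hA⟩ := h
  have := A.map_smul_univ (fun _ => c) fun _ => x
  rw [hA, hA]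
  simpa using this

theorem IsHomogPoly.norm_le_of_norm_le_on_ball {R : E → F} (h : IsHomogPoly k R) {C : ℝ}
    (hC : ∀ x, ‖x‖ ≤ 1 → ‖R x‖ ≤ C) (x : E) : ‖R x‖ ≤ C * ‖x‖ ^ k := by
  rcases eq_or_ne x 0 with rfl | hx
  · have h1 := h.map_smul 0 (0 : E)
    rw [zero_smul] at h1
    rw [h1, norm_smul, norm_zero, norm_pow, norm_zero, mul_comm]
    gcongr
    exact hC 0 (by simp)
  have hx' : 0 < ‖x‖ := norm_pos_iff.mpr hx
  have h1 : R x = ‖x‖ ^ k • R (‖x‖⁻¹ • x) := by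
    rw [← h.map_smul, smul_smul, mul_inv_cancel₀ hx'.ne', one_smul]
  rw [h1, norm_smul, norm_pow, norm_norm, mul_comm]
  gcongr
  exact hC _ (by rw [norm_smul, norm_inv, norm_norm, inv_mul_cancel₀ hx'.ne'])

namespace HPoly

@[ext]
theorem ext {P Q : HPoly k E} (h : ∀ x, P x = Q x) : P = Q := Subtype.ext (funext h)

theorem isHomogPoly (P : HPoly k E) : IsHomogPoly k (fun x => P x) := P.2

/-- A continuous homogeneous polynomial as an element of `HPoly k E`. -/
def of (R : E → ℝ) (h : IsHomogPoly k R) : HPoly k E := ⟨R, h⟩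

@[simp] theorem of_apply (R : E → ℝ) (h : IsHomogPoly k R) (x : E) : of R h x = R x := rfl

@[simp] theorem zero_apply (x : E) : (0 : HPoly k E) x = 0 := rfl

@[simp] theorem add_apply (P Q : HPoly k E) (x : E) : (P + Q) x = P x + Q x := rfl

@[simp] theorem sub_apply (P Q : HPoly k E) (x : E) : (P - Q) x = P x - Q x := rfl

@[simp] theorem smul_apply (c : ℝ) (P : HPoly k E) (x : E) : (c • P) x = c * P x := rfl

theorem norm_le {P : HPoly k E} {C : ℝ} (hC : 0 ≤ C) (h : ∀ x, ‖x‖ ≤ 1 → |P x| ≤ C) : ‖P‖ ≤ C :=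
  (BoundedContinuousFunction.norm_le (f := homogPolyRestrict k E P) hC).mpr fun x =>
    h x.1 (mem_closedBall_zero_iff.mp x.2)

theorem abs_apply_le (P : HPoly k E) (x : E) : |P x| ≤ ‖P‖ * ‖x‖ ^ k :=
  P.isHomogPoly.norm_le_of_norm_le_on_ball (fun x hx =>
    (homogPolyRestrict k E P).norm_coe_le_norm ⟨x, mem_closedBall_zero_iff.mpr hx⟩) x

/-- Evaluation at a point, as a functional on `HPoly k E`. -/
def eval (k : ℕ) {E : Type*} [NormedAddCommGroup E] [NormedSpace ℝ E] (x : E) :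
    StrongDual ℝ (HPoly k E) :=
  LinearMap.mkContinuous
    { toFun := fun P => P x
      map_add' := fun _ _ => rfl
      map_smul' := fun _ _ => rfl } (‖x‖ ^ k) fun P => by
    rw [mul_comm]; exact P.abs_apply_le x

@[simp] theorem eval_apply (x : E) (P : HPoly k E) : eval k x P = P x := rfl

theorem norm_eval_le (x : E) : ‖eval k x‖ ≤ ‖x‖ ^ k :=
  LinearMap.mkContinuous_norm_le _ (by positivity) _

theorem isHomogPoly_eval : IsHomogPoly k (fun x : E => eval k x) :=
  isHomogPoly_of_separating (ι := HPoly k E)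
    (fun P => (ContinuousLinearMap.apply ℝ ℝ P).toLinearMap)
    (fun _ _ h => ContinuousLinearMap.ext h) (fun P => P.isHomogPoly) zero_le_one
    fun x => by simpa using norm_eval_le x

/-- The restriction to the evaluations of an element of the bidual. -/
def ofBidual (ξ : StrongDual ℝ (StrongDual ℝ (HPoly k E))) : HPoly k E :=
  of (fun x => ξ (eval k x)) (isHomogPoly_eval.clm_comp ξ)

@[simp] theorem ofBidual_apply (ξ : StrongDual ℝ (StrongDual ℝ (HPoly k E))) (x : E) :
    ofBidual ξ x = ξ (eval k x) := rfl

theorem exists_tendsto_ultrafilter {ι : Type*} (𝒰 : Ultrafilter ι) (P : ι → HPoly k E) {C : ℝ}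
    (hP : ∀ n, ‖P n‖ ≤ C) : ∃ Q : HPoly k E, ∀ x, Tendsto (fun n => P n x) 𝒰 (𝓝 (Q x)) := by
  obtain ⟨ξ, hξ⟩ := exists_forall_tendsto_ultrafilter 𝒰
    (fun n => inclusionInDoubleDual ℝ (HPoly k E) (P n)) (R := C) fun n =>
      (double_dual_bound ℝ _ _).trans (hP n)
  exact ⟨ofBidual ξ, fun x => hξ (eval k x)⟩

/-- A pointwise limit of a bounded sequence of homogeneous polynomials. -/
theorem exists_eq_of_tendsto (P : ℕ → HPoly k E) {C : ℝ} (hP : ∀ n, ‖P n‖ ≤ C) (R : E → ℝ)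
    (h : ∀ x, Tendsto (fun n => P n x) atTop (𝓝 (R x))) : ∃ Q : HPoly k E, ∀ x, Q x = R x := by
  obtain ⟨Q, hQ⟩ := exists_tendsto_ultrafilter (hyperfilter ℕ) P hP
  exact ⟨Q, fun x => tendsto_nhds_unique (hQ x)
    ((h x).mono_left (by rw [← Nat.cofinite_eq_atTop]; exact hyperfilter_le_cofinite))⟩

/-- Composition with a continuous linear map. -/
def comp (P : HPoly k E) (L : F →L[ℝ] E) : HPoly k F := of _ (P.isHomogPoly.comp_clm L)

@[simp] theorem comp_apply (P : HPoly k E) (L : F →L[ℝ] E) (x : F) : P.comp L x = P (L x) := rfl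

theorem norm_comp_le (P : HPoly k E) (L : F →L[ℝ] E) : ‖P.comp L‖ ≤ ‖P‖ * ‖L‖ ^ k :=
  norm_le (by positivity) fun x hx => (P.abs_apply_le _).trans (by
    gcongr
    exact L.unit_le_opNorm x hx)

end HPoly

end PolynomialSpace

section WeakTopology

variable {W F : Type*} [NormedAddCommGroup W] [NormedSpace ℝ W]
  [NormedAddCommGroup F] [NormedSpace ℝ F]

theorem exists_dual_eq_zero_of_notMem {M : Submodule ℝ W} (hM : IsClosed (M : Set W)) {w : W}
    (hw : w ∉ M) : ∃ f : StrongDual ℝ W, (∀ m ∈ M, f m = 0) ∧ f w = 1 := by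
  obtain ⟨f, c, hfw, hfM⟩ := geometric_hahn_banach_point_closed M.convex hM hw
  have h0 : c < 0 := by simpa using hfM 0 M.zero_mem
  have hM0 : ∀ m ∈ M, f m = 0 := by
    intro m hm
    by_contra hne
    have := hfM ((c / f m) • m) (M.smul_mem _ hm)
    rw [map_smul, smul_eq_mul, div_mul_cancel₀ _ hne] at this
    exact lt_irrefl _ this
  refine ⟨(f w)⁻¹ • f, fun m hm => by simp [hM0 m hm], ?_⟩
  simp [(hfw.trans h0).ne]

theorem isClosed_range_inclusionInDoubleDual [CompleteSpace W] :
    IsClosed (Set.range (inclusionInDoubleDual ℝ W)) := by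
  have h : Isometry (inclusionInDoubleDual ℝ W) := (inclusionInDoubleDualLi ℝ (E := W)).isometry
  exact h.isClosedEmbedding.isClosed_range

theorem weakSpace_t2Space : T2Space (WeakSpace ℝ W) :=
  (isEmbedding_inclusionInDoubleDualWeak ℝ W).t2Space

theorem continuous_dual_weakSpace (f : StrongDual ℝ W) :
    Continuous fun w : WeakSpace ℝ W => f ((toWeakSpace ℝ W).symm w) :=
  WeakBilin.eval_continuous _ f

theorem continuous_weakSpace_of_forall {X : Type*} [TopologicalSpace X] {g : X → W}
    (h : ∀ f : StrongDual ℝ W, Continuous fun x => f (g x)) :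
    Continuous fun x => toWeakSpace ℝ W (g x) :=
  WeakBilin.continuous_of_continuous_eval _ h

variable {k : ℕ} {E : Type*} [NormedAddCommGroup E] [NormedSpace ℝ E]

theorem weaklyCompactMap_of_reflexive [CompleteSpace F]
    (hr : Function.Surjective (inclusionInDoubleDual ℝ (HPoly k E)))
    {P : E → F} (hP : IsHomogPoly k P) : WeaklyCompactMap P := by
  obtain ⟨C, hC, hb⟩ := hP.exists_bound
  let L : StrongDual ℝ F →L[ℝ] HPoly k E := LinearMap.mkContinuous
    { toFun := fun φ => HPoly.of _ (hP.clm_comp φ)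
      map_add' := fun _ _ => rfl
      map_smul' := fun _ _ => rfl } C fun φ => by
    refine HPoly.norm_le (by positivity) fun x hx => ?_
    refine (φ.le_opNorm (P x)).trans ?_
    rw [mul_comm]
    gcongr
    exact (hb x).trans (mul_le_of_le_one_right hC (pow_le_one₀ (norm_nonneg _) hx))
  have hL : ∀ φ x, L φ x = φ (P x) := fun _ _ => rfl
  let T : StrongDual ℝ (HPoly k E) →L[ℝ] StrongDual ℝ (StrongDual ℝ F) :=
    ContinuousLinearMap.precomp ℝ L
  have hT : ∀ ζ φ, T ζ φ = ζ (L φ) := fun _ _ => rfl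
  let M : Submodule ℝ (StrongDual ℝ (HPoly k E)) :=
    (LinearMap.range (inclusionInDoubleDual ℝ F).toLinearMap).comap T.toLinearMap
  have hMc : IsClosed (M : Set (StrongDual ℝ (HPoly k E))) :=
    (isClosed_range_inclusionInDoubleDual (W := F)).preimage T.continuous
  have hMe : ∀ x, HPoly.eval k x ∈ M := fun x => ⟨P x, by ext φ; exact (hL φ x).symm⟩
  have hMtop : ∀ ζ, ζ ∈ M := by
    intro ζ
    by_contra hζ
    obtain ⟨Ξ, h0, h1⟩ := exists_dual_eq_zero_of_notMem hMc hζ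
    obtain ⟨Q, rfl⟩ := hr Ξ
    have : Q = 0 := HPoly.ext fun x => h0 _ (hMe x)
    simp [this] at h1
  choose g hg using hMtop
  have hg' : ∀ ζ (φ : StrongDual ℝ F), φ (g ζ) = ζ (L φ) := fun ζ φ =>
    DFunLike.congr_fun (hg ζ) φ
  intro s hs
  obtain ⟨r, hr0, hr⟩ := hs.exists_pos_norm_le
  have := weakSpace_t2Space (W := F)
  have hK := (WeakDual.isCompact_closedBall (𝕜 := ℝ) (E := HPoly k E) 0 (r ^ k)).image
    (continuous_weakSpace_of_forall (g := fun ζ => g (WeakDual.toStrongDual ζ)) fun f => by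
      simp only [hg']
      exact WeakDual.eval_continuous (L f))
  refine hK.closure_of_subset ?_
  rintro _ ⟨_, ⟨x, hx, rfl⟩, rfl⟩
  refine ⟨StrongDual.toWeakDual (HPoly.eval k x), ?_, ?_⟩
  · have := (HPoly.norm_eval_le (k := k) x).trans (pow_le_pow_left₀ (norm_nonneg _) (hr x hx) k)
    simpa using this
  · refine congrArg _ ((SeparatingDual.eq_iff_forall_dual_eq (R := ℝ)).mpr fun φ => ?_)
    exact hg' _ φ

end WeakTopology

section NullSequences

theorem tendsto_of_nonneg_of_tendsto_pointwise {X : Type*} [TopologicalSpace X] [CompactSpace X]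
    [T2Space X] (Λ : C(X, ℝ) →ₗ[ℝ] ℝ) (hΛ : ∀ f, 0 ≤ f → 0 ≤ Λ f) (g : ℕ → C(X, ℝ)) {C : ℝ}
    (hg : ∀ n x, |g n x| ≤ C) (h0 : ∀ x, Tendsto (fun n => g n x) atTop (𝓝 0)) :
    Tendsto (fun n => Λ (g n)) atTop (𝓝 0) := by
  let e := CompactlySupportedContinuousMap.continuousMapEquiv (α := X) (β := ℝ)
  let Λ' : CompactlySupportedContinuousMap X ℝ →ₚ[ℝ] ℝ := PositiveLinearMap.mk₀
    { toFun := fun f => Λ (e.symm f)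
      map_add' := fun f g => Λ.map_add (e.symm f) (e.symm g)
      map_smul' := fun c f => Λ.map_smul c (e.symm f) }
    fun f hf => hΛ _ hf
  borelize X
  let μ := RealRMK.rieszMeasure Λ'
  have hμ : MeasureTheory.IsFiniteMeasure μ := ⟨isCompact_univ.measure_lt_top⟩
  have hintegral : ∀ f : C(X, ℝ), Λ f = ∫ x, f x ∂μ := fun f =>
    (RealRMK.integral_rieszMeasure Λ' (e f)).symm
  simp only [hintegral]
  have := MeasureTheory.tendsto_integral_of_dominated_convergence (μ := μ)
    (F := fun n x => g n x) (f := fun _ => 0) (fun _ => C)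
    (fun n => (g n).continuous.aestronglyMeasurable) (MeasureTheory.integrable_const C)
    (fun n => Eventually.of_forall fun x => hg n x) (Eventually.of_forall h0)
  simpa using this

/-- The coordinate functionals of `c₀`. -/
def coordCLM (n : ℕ) : StrongDual ℝ C₀(ℕ, ℝ) :=
  LinearMap.mkContinuous
    { toFun := fun f => f n
      map_add' := fun _ _ => rfl
      map_smul' := fun _ _ => rfl } 1 fun f => by
    rw [one_mul]
    exact f.toBCF.norm_coe_le_norm n

@[simp] theorem coordCLM_apply (n : ℕ) (f : C₀(ℕ, ℝ)) : coordCLM n f = f n := rfl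

theorem tendsto_apply_zeroAtInfty (f : C₀(ℕ, ℝ)) : Tendsto (fun n => f n) atTop (𝓝 0) := by
  have := f.zero_at_infty'
  rwa [cocompact_eq_cofinite, Nat.cofinite_eq_atTop] at this

variable {k : ℕ} {E : Type*} [NormedAddCommGroup E] [NormedSpace ℝ E]

theorem exists_homogPoly_zeroAtInfty (P : ℕ → HPoly k E) {C : ℝ} (hP : ∀ n, ‖P n‖ ≤ C)
    (h0 : ∀ x, Tendsto (fun n => P n x) atTop (𝓝 0)) :
    ∃ Q : E → C₀(ℕ, ℝ), IsHomogPoly k Q ∧ ∀ x n, Q x n = P n x := by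
  have hC : 0 ≤ C := (norm_nonneg _).trans (hP 0)
  let Q : E → C₀(ℕ, ℝ) := fun x =>
    { toFun := fun n => P n x
      continuous_toFun := continuous_of_discreteTopology
      zero_at_infty' := by rw [cocompact_eq_cofinite, Nat.cofinite_eq_atTop]; exact h0 x }
  refine ⟨Q, isHomogPoly_of_separating (fun n => (coordCLM n).toLinearMap)
    (fun a b h => ZeroAtInftyContinuousMap.ext h) (fun n => (P n).isHomogPoly) hC fun x => ?_,
    fun _ _ => rfl⟩
  rw [← ZeroAtInftyContinuousMap.norm_toBCF_eq_norm]
  refine (BoundedContinuousFunction.norm_le (by positivity)).mpr fun n => ?_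
  refine ((P n).abs_apply_le x).trans ?_
  gcongr
  exact hP n

theorem not_eventually_le_of_weaklyCompact
    (hWC : ∀ Q : E → C₀(ℕ, ℝ), IsHomogPoly k Q → WeaklyCompactMap Q)
    (P : ℕ → HPoly k E) {C : ℝ} (hP : ∀ n, ‖P n‖ ≤ C)
    (h0 : ∀ x, Tendsto (fun n => P n x) atTop (𝓝 0)) (y : ℕ → E) {r : ℝ} (hy : ∀ m, ‖y m‖ ≤ r)
    {c : ℝ} (hc : 0 < c) (h : ∀ᶠ n in atTop, ∀ᶠ m in atTop, c ≤ P n (y m)) : False := by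
  obtain ⟨Q, hQ, hQP⟩ := exists_homogPoly_zeroAtInfty P hP h0
  have hK := hWC Q hQ (Set.range y) (isBounded_iff_forall_norm_le.mpr
    ⟨r, by rintro _ ⟨m, rfl⟩; exact hy m⟩)
  obtain ⟨q, -, hq⟩ := hK.ultrafilter_le_nhds
    ((hyperfilter ℕ).map fun m => toWeakSpace ℝ C₀(ℕ, ℝ) (Q (y m))) (by
      rw [le_principal_iff]
      exact Filter.mem_map.mpr (Filter.univ_mem' fun m =>
        subset_closure ⟨_, ⟨_, ⟨m, rfl⟩, rfl⟩, rfl⟩))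
  have hcoord : ∀ n, Tendsto (fun m => P n (y m)) (hyperfilter ℕ : Ultrafilter ℕ)
      (𝓝 (((toWeakSpace ℝ C₀(ℕ, ℝ)).symm q) n)) := by
    intro n
    simpa [Function.comp_def, hQP] using
      ((continuous_dual_weakSpace (coordCLM n)).tendsto q).comp hq
  have hle : (hyperfilter ℕ : Filter ℕ) ≤ atTop := by
    rw [← Nat.cofinite_eq_atTop]; exact hyperfilter_le_cofinite
  have hge : ∀ᶠ n in atTop, c ≤ ((toWeakSpace ℝ C₀(ℕ, ℝ)).symm q) n :=
    h.mono fun n hn => ge_of_tendsto (hcoord n) (hle hn)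
  exact hc.not_ge (ge_of_tendsto (tendsto_apply_zeroAtInfty _) hge)

theorem tendsto_dual_of_weaklyCompact
    (hWC : ∀ Q : E → C₀(ℕ, ℝ), IsHomogPoly k Q → WeaklyCompactMap Q)
    (P : ℕ → HPoly k E) {C : ℝ} (hP : ∀ n, ‖P n‖ ≤ C)
    (h0 : ∀ x, Tendsto (fun n => P n x) atTop (𝓝 0)) (η : StrongDual ℝ (HPoly k E)) :
    Tendsto (fun n => η (P n)) atTop (𝓝 0) := by
  obtain ⟨Q, hQ, hQP⟩ := exists_homogPoly_zeroAtInfty P hP h0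
  have hK := hWC Q hQ (Metric.closedBall 0 1) Metric.isBounded_closedBall
  have := weakSpace_t2Space (W := C₀(ℕ, ℝ))
  set K := closure (toWeakSpace ℝ C₀(ℕ, ℝ) '' (Q '' Metric.closedBall 0 1)) with hKdef
  have : CompactSpace K := isCompact_iff_compactSpace.mp hK
  let g : ℕ → C(K, ℝ) := fun n =>
    { toFun := fun q => |coordCLM n ((toWeakSpace ℝ C₀(ℕ, ℝ)).symm q.1)|
      continuous_toFun := ((continuous_dual_weakSpace _).comp continuous_subtype_val).abs }
  let pt : ∀ x : E, ‖x‖ ≤ 1 → K := fun x hx => ⟨toWeakSpace ℝ C₀(ℕ, ℝ) (Q x),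
    subset_closure ⟨_, ⟨x, mem_closedBall_zero_iff.mpr hx, rfl⟩, rfl⟩⟩
  have hg : ∀ n x hx, g n (pt x hx) = |P n x| := fun n x hx => by
    rw [← hQP]; rfl
  have hgC : ∀ n q, |g n q| ≤ C := by
    rintro n ⟨q, hq⟩
    change |(|coordCLM n ((toWeakSpace ℝ C₀(ℕ, ℝ)).symm q)|)| ≤ C
    rw [abs_abs]
    refine closure_minimal (t := {q | |coordCLM n ((toWeakSpace ℝ C₀(ℕ, ℝ)).symm q)| ≤ C}) ?_
      (isClosed_le (continuous_dual_weakSpace _).abs continuous_const) hq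
    rintro _ ⟨_, ⟨x, hx, rfl⟩, rfl⟩
    have hx := mem_closedBall_zero_iff.mp hx
    have h1 := ((P n).abs_apply_le x).trans
      (mul_le_of_le_one_right (norm_nonneg _) (pow_le_one₀ (norm_nonneg _) hx))
    simpa [hQP] using h1.trans (hP n)
  have hg0 : ∀ q, Tendsto (fun n => g n q) atTop (𝓝 0) := fun q => by
    have := (tendsto_apply_zeroAtInfty ((toWeakSpace ℝ C₀(ℕ, ℝ)).symm q.1)).abs
    rwa [abs_zero] at this
  rw [Metric.tendsto_atTop]
  by_contra! hcon
  obtain ⟨ε, hε, hfreq⟩ := hcon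
  let ε' := ε / (‖η‖ + 1)
  have hη : 0 < ‖η‖ + 1 := by positivity
  have hε' : 0 < ε' := by positivity
  let O : Set C(K, ℝ) := {f | Set.MapsTo f Set.univ (Set.Iio ε')}
  let B : Set C(K, ℝ) := {f | ∃ R : HPoly k E, ε ≤ η R ∧ ∀ x hx, |R x| ≤ f (pt x hx)}
  have hO : IsOpen O := ContinuousMap.isOpen_setOfPred_mapsTo isCompact_univ isOpen_Iio
  have hOc : Convex ℝ O := fun f hf f' hf' a b ha hb hab q _ =>
    convex_Iio ε' (hf (Set.mem_univ q)) (hf' (Set.mem_univ q)) ha hb hab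
  have hBc : Convex ℝ B := by
    rintro f ⟨R, hR, hf⟩ f' ⟨R', hR', hf'⟩ a b ha hb hab
    refine ⟨a • R + b • R', ?_, fun x hx => ?_⟩
    · rw [map_add, map_smul, map_smul, smul_eq_mul, smul_eq_mul]
      calc ε = a * ε + b * ε := by rw [← add_mul, hab, one_mul]
        _ ≤ _ := by gcongr
    · simp only [HPoly.add_apply, HPoly.smul_apply, ContinuousMap.add_apply,
        ContinuousMap.smul_apply, smul_eq_mul]
      refine (abs_add_le _ _).trans ?_
      rw [abs_mul, abs_mul, abs_of_nonneg ha, abs_of_nonneg hb]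
      gcongr
      · exact hf x hx
      · exact hf' x hx
  have hdisj : Disjoint O B := by
    rw [Set.disjoint_left]
    rintro f hf ⟨R, hR, hRf⟩
    have hRn : ‖R‖ ≤ ε' := HPoly.norm_le hε'.le fun x hx =>
      (hRf x hx).trans (hf (Set.mem_univ (pt x hx))).le
    have h1 : ε ≤ ‖η‖ * ε' := hR.trans ((le_abs_self _).trans ((η.le_opNorm R).trans (by gcongr)))
    have h2 : (‖η‖ + 1) * ε' = ε := mul_div_cancel₀ _ hη.ne'
    linarith
  obtain ⟨Λ, u, hΛO, hΛB⟩ := geometric_hahn_banach_open hOc hO hBc hdisj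
  have hu : 0 < u := by
    have := hΛO 0 fun q _ => hε'
    simpa using this
  have hΛpos : ∀ f, 0 ≤ f → 0 ≤ Λ f := by
    intro f hf
    by_contra! hneg
    have := hΛO ((u / Λ f) • f) fun q _ => by
      have h1 : u / Λ f ≤ 0 := div_nonpos_of_nonneg_of_nonpos hu.le hneg.le
      exact (mul_nonpos_of_nonpos_of_nonneg h1 (hf q)).trans_lt hε'
    rw [map_smul, smul_eq_mul, div_mul_cancel₀ _ hneg.ne] at this
    exact lt_irrefl _ this
  have hlim := tendsto_of_nonneg_of_tendsto_pointwise Λ.toLinearMap hΛpos g hgC hg0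
  obtain ⟨N, hN⟩ := eventually_atTop.mp (hlim.eventually (gt_mem_nhds hu))
  obtain ⟨n, hn, hnε⟩ := hfreq N
  refine (hN n hn).not_ge (hΛB _ ?_)
  rw [Real.dist_eq, sub_zero] at hnε
  rcases le_abs.mp hnε with h | h
  · exact ⟨P n, h, fun x hx => (hg n x hx).ge⟩
  · exact ⟨-P n, by rwa [map_neg], fun x hx => by
      rw [hg n x hx]; exact (abs_neg (P n x)).le⟩

end NullSequences

section ConvexBlocks

variable {W : Type*} [NormedAddCommGroup W] [NormedSpace ℝ W]

/-- `h` is a sequence of convex combinations of tails of `g`. -/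
def IsConvexBlock (h g : ℕ → W) : Prop := ∀ n, h n ∈ convexHull ℝ (g '' Set.Ici n)

theorem IsConvexBlock.refl (g : ℕ → W) : IsConvexBlock g g := fun n =>
  subset_convexHull ℝ _ ⟨n, Set.self_mem_Ici, rfl⟩

theorem IsConvexBlock.mem_of_forall {h g : ℕ → W} (hhg : IsConvexBlock h g) {s : Set W}
    (hs : Convex ℝ s) {n : ℕ} (hg : ∀ j, n ≤ j → g j ∈ s) : h n ∈ s :=
  convexHull_min (by rintro _ ⟨j, hj, rfl⟩; exact hg j hj) hs (hhg n)

theorem IsConvexBlock.mem_convexHull {h g : ℕ → W} (hhg : IsConvexBlock h g) {n i : ℕ}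
    (hi : i ≤ n) : h n ∈ convexHull ℝ (g '' Set.Ici i) :=
  convexHull_mono (Set.image_mono (Set.Ici_subset_Ici.mpr hi)) (hhg n)

theorem IsConvexBlock.trans {h g e : ℕ → W} (hhg : IsConvexBlock h g) (hge : IsConvexBlock g e) :
    IsConvexBlock h e := fun _ =>
  hhg.mem_of_forall (convex_convexHull ℝ _) fun _ hj => hge.mem_convexHull hj

theorem convex_setOf_apply_le (x : W) (c : ℝ) : Convex ℝ {φ : StrongDual ℝ W | φ x ≤ c} :=
  convex_halfSpace_le (ContinuousLinearMap.apply ℝ ℝ x).isLinear c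

theorem convex_setOf_le_apply (x : W) (c : ℝ) : Convex ℝ {φ : StrongDual ℝ W | c ≤ φ x} :=
  convex_halfSpace_ge (ContinuousLinearMap.apply ℝ ℝ x).isLinear c

theorem exists_triangular_of_not_reflexive [CompleteSpace W]
    (h : ¬ Function.Surjective (inclusionInDoubleDual ℝ W)) :
    ∃ (f : ℕ → StrongDual ℝ W) (x : ℕ → W) (r : ℝ), (∀ n, ‖f n‖ ≤ r) ∧ (∀ n, ‖x n‖ ≤ r) ∧
      (∀ n m, n ≤ m → 3 / 4 ≤ f n (x m)) ∧ ∀ m n, m < n → f n (x m) ≤ 1 / 8 := by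
  rw [Function.Surjective] at h
  push Not at h
  obtain ⟨z, hz⟩ := h
  let M : Submodule ℝ (StrongDual ℝ (StrongDual ℝ W)) :=
    LinearMap.range (inclusionInDoubleDual ℝ W).toLinearMap
  have hM : IsClosed (M : Set (StrongDual ℝ (StrongDual ℝ W))) :=
    isClosed_range_inclusionInDoubleDual
  obtain ⟨ξ, hξ0, hξ1⟩ := exists_dual_eq_zero_of_notMem hM (w := z) (by rintro ⟨a, ha⟩; exact hz a ha)
  obtain ⟨f, u, hf, hu, h1, h2⟩ := exists_triangular_system
    (U := inclusionInDoubleDual ℝ W '' Metric.closedBall 0 ‖z‖)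
    ((convex_closedBall _ _).linear_image (inclusionInDoubleDual ℝ W).toLinearMap) z
    (fun ζ c hc => apply_le_of_forall_closedBall fun w hw => by
      simpa using hc _ ⟨w, by simpa using hw, rfl⟩) ξ hξ1
    (by rintro _ ⟨w, -, rfl⟩; exact hξ0 _ ⟨w, rfl⟩)
  choose x hx hxu using hu
  obtain rfl : (fun n => inclusionInDoubleDual ℝ W (x n)) = u := funext hxu
  exact ⟨f, x, max ‖ξ‖ ‖z‖, fun n => (hf n).trans (le_max_left _ _),
    fun n => (mem_closedBall_zero_iff.mp (hx n)).trans (le_max_right _ _), h1, h2⟩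

theorem exists_convexBlock_tendsto (f : ℕ → StrongDual ℝ W) {r : ℝ} (hf : ∀ n, ‖f n‖ ≤ r)
    (h : ∀ δ : ℝ, 0 < δ → ∀ g, IsConvexBlock g f → ∃ e, IsConvexBlock e g ∧
      ∀ x, ‖x‖ ≤ 1 → ∃ i, ∀ n l, i ≤ n → i ≤ l → e n x - e l x ≤ δ) :
    ∃ (d : ℕ → StrongDual ℝ W) (φ : StrongDual ℝ W), IsConvexBlock d f ∧
      ∀ x, Tendsto (fun n => d n x) atTop (𝓝 (φ x)) := by
  have hstep : ∀ (i : ℕ) (g : {g : ℕ → StrongDual ℝ W // IsConvexBlock g f}),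
      ∃ e : {g : ℕ → StrongDual ℝ W // IsConvexBlock g f}, IsConvexBlock e.1 g.1 ∧
        ∀ x, ‖x‖ ≤ 1 → ∃ j, ∀ n l, j ≤ n → j ≤ l → e.1 n x - e.1 l x ≤ 1 / (i + 1 : ℝ) := by
    intro i g
    obtain ⟨e, he, hex⟩ := h (1 / (i + 1 : ℝ)) (by positivity) g.1 g.2
    exact ⟨⟨e, he.trans g.2⟩, he, hex⟩
  choose next hnext hosc using hstep
  let G : ℕ → {g : ℕ → StrongDual ℝ W // IsConvexBlock g f} := fun n =>
    Nat.rec ⟨f, IsConvexBlock.refl f⟩ next n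
  have hG : ∀ i j, i ≤ j → IsConvexBlock (G j).1 (G i).1 := by
    intro i j hij
    induction j, hij using Nat.le_induction with
    | base => exact IsConvexBlock.refl _
    | succ j _ ih => exact (hnext j (G j)).trans ih
  let d : ℕ → StrongDual ℝ W := fun i => (G i).1 i
  have hd : IsConvexBlock d f := fun n => (G n).2 n
  have hdr : ∀ n, ‖d n‖ ≤ r := fun n => by
    simpa using hd.mem_of_forall (convex_closedBall 0 r) (n := n) fun j _ => by simpa using hf j
  obtain ⟨φ, hφ⟩ := exists_forall_tendsto_ultrafilter (hyperfilter ℕ) d hdr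
  have hle : (hyperfilter ℕ : Filter ℕ) ≤ atTop := by
    rw [← Nat.cofinite_eq_atTop]; exact hyperfilter_le_cofinite
  have hball : ∀ x, ‖x‖ ≤ 1 → Tendsto (fun n => d n x) atTop (𝓝 (φ x)) := by
    intro x hx
    have hosc' : ∀ i : ℕ, ∃ N, ∀ n l, N ≤ n → N ≤ l → d n x - d l x ≤ 1 / (i + 1 : ℝ) := by
      intro i
      obtain ⟨j, hj⟩ := hosc i (G i) x hx
      refine ⟨max j (i + 1), fun n l hn hl => ?_⟩
      have hmem : ∀ n, max j (i + 1) ≤ n → ∀ s : Set (StrongDual ℝ W), Convex ℝ s →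
          (∀ a, j ≤ a → (G (i + 1)).1 a ∈ s) → d n ∈ s := fun n hn s hs h =>
        (hG (i + 1) n ((le_max_right _ _).trans hn)).mem_of_forall hs fun a ha =>
          h a (((le_max_left _ _).trans hn).trans ha)
      have h1 : ∀ b, j ≤ b → d n x ≤ 1 / (i + 1 : ℝ) + (G (i + 1)).1 b x := fun b hb =>
        hmem n hn _ (convex_setOf_apply_le x _) fun a ha => by
          have : (G (i + 1)).1 a x - (G (i + 1)).1 b x ≤ 1 / (i + 1 : ℝ) := hj a b ha hb
          change (G (i + 1)).1 a x ≤ _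
          linarith
      have h2 : d n x - 1 / (i + 1 : ℝ) ≤ d l x :=
        hmem l hl _ (convex_setOf_le_apply x _) fun b hb => by
          have := h1 b hb
          change _ ≤ (G (i + 1)).1 b x
          linarith
      linarith
    have hc : CauchySeq fun n => d n x := by
      refine Metric.cauchySeq_iff.mpr fun ε hε => ?_
      obtain ⟨i, hi⟩ := exists_nat_one_div_lt hε
      obtain ⟨N, hN⟩ := hosc' i
      refine ⟨N, fun n hn l hl => ?_⟩
      rw [Real.dist_eq, abs_lt]
      constructor <;> linarith [hN n l hn hl, hN l n hl hn]
    obtain ⟨a, ha⟩ := cauchySeq_tendsto_of_complete hc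
    rwa [tendsto_nhds_unique (hφ x) (ha.mono_left hle)]
  refine ⟨d, φ, hd, fun x => ?_⟩
  rcases eq_or_ne x 0 with rfl | hx
  · simp
  have hx' : ‖x‖ ≠ 0 := norm_ne_zero_iff.mpr hx
  have h1 := (hball (‖x‖⁻¹ • x) (by
    rw [norm_smul, norm_inv, norm_norm, inv_mul_cancel₀ hx'])).const_mul ‖x‖
  simpa [mul_inv_cancel_left₀ hx'] using h1

/-- A stage of the construction of a sequence of functionals with square summable values. -/
structure SquareStage (W : Type*) [NormedAddCommGroup W] [NormedSpace ℝ W]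
    (g : ℕ → StrongDual ℝ W) (r δ : ℝ) (m : ℕ) where
  /-- The current convex blocks. -/
  h : ℕ → StrongDual ℝ W
  /-- The half differences constructed so far. -/
  t : ℕ → ℕ → StrongDual ℝ W
  /-- The points constructed so far. -/
  x : ℕ → W
  isConvexBlock : IsConvexBlock h g
  sq_add_sum_le : ∀ i y, h i y ^ 2 + ∑ j ∈ Finset.range m, t i j y ^ 2 ≤ r ^ 2 * ‖y‖ ^ 2
  le_apply : ∀ i j, j < m → δ / 2 ≤ t i j (x j)
  norm_le : ∀ j, j < m → ‖x j‖ ≤ 1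

theorem SquareStage.exists_succ {g : ℕ → StrongDual ℝ W} {r δ : ℝ}
    (hosc : ∀ h, IsConvexBlock h g → ∃ x, ‖x‖ ≤ 1 ∧
      ∀ i, ∃ n l, i ≤ n ∧ i ≤ l ∧ δ < h n x - h l x) (m : ℕ) (s : SquareStage W g r δ m) :
    ∃ s' : SquareStage W g r δ (m + 1), ∀ j < m, s'.x j = s.x j := by
  obtain ⟨x, hx, hxi⟩ := hosc s.h s.isConvexBlock
  choose n l hn hl hnl using hxi
  refine ⟨{
    h := fun i => (1 / 2 : ℝ) • s.h (n i) + (1 / 2 : ℝ) • s.h (l i)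
    t := fun i j => if j < m then (1 / 2 : ℝ) • s.t (n i) j + (1 / 2 : ℝ) • s.t (l i) j
      else (1 / 2 : ℝ) • (s.h (n i) - s.h (l i))
    x := fun j => if j < m then s.x j else x
    isConvexBlock := fun i => convex_convexHull ℝ _ (s.isConvexBlock.mem_convexHull (hn i))
      (s.isConvexBlock.mem_convexHull (hl i)) (by norm_num) (by norm_num) (by norm_num)
    sq_add_sum_le := fun i y => ?_
    le_apply := fun i j hj => ?_
    norm_le := fun j hj => ?_ }, fun j hj => if_pos hj⟩
  · have h1 : ∑ j ∈ Finset.range m, (if j < m then (1 / 2 : ℝ) • s.t (n i) j +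
        (1 / 2 : ℝ) • s.t (l i) j else (1 / 2 : ℝ) • (s.h (n i) - s.h (l i))) y ^ 2 ≤
        1 / 2 * ∑ j ∈ Finset.range m, s.t (n i) j y ^ 2 +
          1 / 2 * ∑ j ∈ Finset.range m, s.t (l i) j y ^ 2 := by
      rw [Finset.mul_sum, Finset.mul_sum, ← Finset.sum_add_distrib]
      refine Finset.sum_le_sum fun j hj => ?_
      rw [if_pos (Finset.mem_range.mp hj)]
      simp only [add_apply, smul_apply, smul_eq_mul]
      nlinarith [sq_nonneg (s.t (n i) j y - s.t (l i) j y)]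
    rw [Finset.sum_range_succ]
    simp only [lt_irrefl, if_false, add_apply, smul_apply, sub_apply, smul_eq_mul] at h1 ⊢
    nlinarith [s.sq_add_sum_le (n i) y, s.sq_add_sum_le (l i) y]
  · rcases Nat.lt_succ_iff_lt_or_eq.mp hj with hj | rfl
    · simp only [if_pos hj, add_apply, smul_apply, smul_eq_mul]
      linarith [s.le_apply (n i) j hj, s.le_apply (l i) j hj]
    · simp only [lt_irrefl, if_false, smul_apply, sub_apply, smul_eq_mul]
      linarith [hnl i]
  · split_ifs with h
    · exact s.norm_le j h
    · exact hx

theorem exists_square_bounded_system {g : ℕ → StrongDual ℝ W} {r δ : ℝ} (hg : ∀ n, ‖g n‖ ≤ r)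
    (hosc : ∀ h, IsConvexBlock h g → ∃ x, ‖x‖ ≤ 1 ∧
      ∀ i, ∃ n l, i ≤ n ∧ i ≤ l ∧ δ < h n x - h l x) :
    ∃ (T : ℕ → StrongDual ℝ W) (x : ℕ → W), (∀ j, ‖x j‖ ≤ 1) ∧ (∀ j, δ / 2 ≤ T j (x j)) ∧
      ∀ M y, ∑ j ∈ Finset.range M, T j y ^ 2 ≤ r ^ 2 * ‖y‖ ^ 2 := by
  have hr : 0 ≤ r := (norm_nonneg _).trans (hg 0)
  choose next hnext using fun m (s : SquareStage W g r δ m) => s.exists_succ hosc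
  let S : ∀ m, SquareStage W g r δ m := fun m => Nat.rec
    { h := g
      t := fun _ _ => 0
      x := fun _ => 0
      isConvexBlock := IsConvexBlock.refl g
      sq_add_sum_le := fun i y => by
        simp only [Finset.range_zero, Finset.sum_empty, add_zero]
        rw [← mul_pow, ← sq_abs]
        gcongr
        exact (g i).le_of_opNorm_le (hg i) y
      le_apply := fun _ _ h => absurd h (Nat.not_lt_zero _)
      norm_le := fun _ h => absurd h (Nat.not_lt_zero _) } next m
  have hS : ∀ j m, j + 1 ≤ m → (S m).x j = (S (j + 1)).x j := by
    intro j m hjm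
    induction m, hjm using Nat.le_induction with
    | base => rfl
    | succ m hm ih => exact (hnext m (S m) j hm).trans ih
  let τ : ℕ → ℕ → StrongDual ℝ W := fun j m => if j < m then (S m).t 0 j else 0
  have hτ : ∀ j m y, j < m → τ j m y = (S m).t 0 j y := fun j m y h => by simp [τ, h]
  have hτr : ∀ j m, ‖τ j m‖ ≤ r := by
    intro j m
    by_cases hjm : j < m
    · refine ContinuousLinearMap.opNorm_le_bound _ hr fun y => abs_le_of_sq_le_sq ?_ (by positivity)
      rw [hτ j m y hjm, mul_pow]
      have h1 := (S m).sq_add_sum_le 0 y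
      have h2 := Finset.single_le_sum (f := fun j => (S m).t 0 j y ^ 2)
        (fun _ _ => sq_nonneg _) (Finset.mem_range.mpr hjm)
      linarith [sq_nonneg ((S m).h 0 y)]
    · simpa [τ, hjm] using hr
  choose T hT using fun j => exists_forall_tendsto_ultrafilter (hyperfilter ℕ) (τ j) (hτr j)
  have hle : (hyperfilter ℕ : Filter ℕ) ≤ atTop := by
    rw [← Nat.cofinite_eq_atTop]; exact hyperfilter_le_cofinite
  refine ⟨T, fun j => (S (j + 1)).x j, fun j => (S (j + 1)).norm_le j j.lt_succ_self, fun j => ?_,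
    fun M y => ?_⟩
  · refine ge_of_tendsto (hT j _) (hle ((eventually_ge_atTop (j + 1)).mono fun m hm => ?_))
    rw [hτ j m _ hm]
    beta_reduce
    rw [← hS j m hm]
    exact (S m).le_apply 0 j hm
  · refine le_of_tendsto (tendsto_finsetSum _ fun j _ => (hT j y).pow 2)
      (hle ((eventually_ge_atTop M).mono fun m hm => ?_))
    have h1 := (S m).sq_add_sum_le 0 y
    have h2 : ∑ j ∈ Finset.range M, τ j m y ^ 2 ≤ ∑ j ∈ Finset.range m, (S m).t 0 j y ^ 2 := by
      refine (Finset.sum_congr rfl fun j hj => ?_).trans_le (Finset.sum_le_sum_of_subset_of_nonneg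
        (Finset.range_mono hm) fun _ _ _ => sq_nonneg _)
      rw [hτ j m y ((Finset.mem_range.mp hj).trans_le hm)]
    linarith [sq_nonneg ((S m).h 0 y)]

end ConvexBlocks

section ReflexiveDomain

variable {k : ℕ} {E : Type*} [NormedAddCommGroup E] [NormedSpace ℝ E]

theorem not_tendsto_convexBlock_of_weaklyCompact
    (hWC : ∀ Q : E → C₀(ℕ, ℝ), IsHomogPoly (k + 1) Q → WeaklyCompactMap Q)
    {f : ℕ → StrongDual ℝ E} {x : ℕ → E} {r : ℝ} (hf : ∀ n, ‖f n‖ ≤ r) (hx : ∀ n, ‖x n‖ ≤ r)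
    (h1 : ∀ n m, n ≤ m → 3 / 4 ≤ f n (x m)) (h2 : ∀ m n, m < n → f n (x m) ≤ 1 / 8)
    {d : ℕ → StrongDual ℝ E} (hd : IsConvexBlock d f) (φ : StrongDual ℝ E)
    (hφ : ∀ y, Tendsto (fun n => d n y) atTop (𝓝 (φ y))) : False := by
  have hr : 0 ≤ r := (norm_nonneg _).trans (hf 0)
  have hdr : ∀ n, ‖d n‖ ≤ r := fun n => by
    simpa using hd.mem_of_forall (convex_closedBall 0 r) (n := n) fun j _ => by simpa using hf j
  have hφx : ∀ m, φ (x m) ≤ 1 / 8 := fun m =>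
    le_of_tendsto (hφ (x m)) ((eventually_gt_atTop m).mono fun n hn =>
      hd.mem_of_forall (convex_setOf_apply_le (x m) _) fun j hj => h2 m j (hn.trans_le hj))
  have hdx : ∀ n, ∀ᶠ m in atTop, 3 / 4 ≤ d n (x m) := by
    intro n
    refine hd.mem_of_forall (s := {ψ | ∀ᶠ m in atTop, 3 / 4 ≤ ψ (x m)}) (n := n) ?_ fun j _ =>
      (eventually_ge_atTop j).mono fun m hm => h1 j m hm
    intro ψ hψ ψ' hψ' a b ha hb hab
    change ∀ᶠ m in atTop, _
    filter_upwards [hψ, hψ'] with m h h'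
    exact convex_setOf_le_apply (x m) (3 / 4) h h' ha hb hab
  let P : ℕ → HPoly (k + 1) E := fun n => HPoly.of _ ((isHomogPoly_pow k (f 0)).clm_mul (d n - φ))
  have hP : ∀ n y, P n y = (d n y - φ y) * f 0 y ^ k := fun _ _ => rfl
  refine not_eventually_le_of_weaklyCompact hWC P (C := (r + ‖φ‖) * r ^ k) (fun n => ?_)
    (fun y => ?_) x hx (c := 1 / 2 * (3 / 4) ^ k) (by positivity) (Eventually.of_forall fun n => ?_)
  · refine HPoly.norm_le (by positivity) fun y hy => ?_
    rw [hP, abs_mul, abs_pow]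
    gcongr
    · exact (abs_sub _ _).trans (add_le_add ((d n).le_of_opNorm_le_of_le (hdr n) hy |>.trans_eq
        (mul_one r)) ((φ.le_of_opNorm_le_of_le le_rfl hy).trans_eq (mul_one _)))
    · exact ((f 0).le_of_opNorm_le_of_le (hf 0) hy).trans_eq (mul_one r)
  · simp only [hP]
    simpa using ((hφ y).sub_const (φ y)).mul_const (f 0 y ^ k)
  · filter_upwards [hdx n] with m hm
    rw [hP]
    gcongr
    · linarith [hφx m]
    · linarith [hφx m]
    · exact h1 0 m (Nat.zero_le m)

theorem not_square_bounded_system_of_weaklyCompact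
    (hWC : ∀ Q : E → C₀(ℕ, ℝ), IsHomogPoly (k + 2) Q → WeaklyCompactMap Q)
    {f : StrongDual ℝ E} (hf : f ≠ 0) {T : ℕ → StrongDual ℝ E} {x : ℕ → E} {r δ : ℝ} (hδ : 0 < δ)
    (hx : ∀ j, ‖x j‖ ≤ 1) (hTx : ∀ j, δ ≤ T j (x j))
    (hT : ∀ M y, ∑ j ∈ Finset.range M, T j y ^ 2 ≤ r ^ 2 * ‖y‖ ^ 2) : False := by
  obtain ⟨u, hu⟩ : ∃ u, f u = ‖f‖ + 1 := by
    obtain ⟨v, hv⟩ : ∃ v, f v ≠ 0 := by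
      by_contra! h
      exact hf (ContinuousLinearMap.ext h)
    exact ⟨((‖f‖ + 1) / f v) • v, by rw [map_smul, smul_eq_mul, div_mul_cancel₀ _ hv]⟩
  have hsum : ∀ y, Summable fun j => T j y ^ 2 := fun y =>
    summable_of_sum_range_le (fun _ => sq_nonneg _) fun M => hT M y
  let S : ℕ → ℕ → HPoly (k + 2) E := fun n M => ∑ j ∈ Finset.range M, if j < n then 0 else
    HPoly.of _ (((isHomogPoly_pow k f).clm_mul (T j)).clm_mul (T j))
  have hS : ∀ n M y, S n M y =
      (∑ j ∈ Finset.range M, if j < n then 0 else T j y ^ 2) * f y ^ k := by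
    intro n M y
    change HPoly.eval (k + 2) y (S n M) = _
    rw [map_sum, Finset.sum_mul]
    refine Finset.sum_congr rfl fun j _ => ?_
    split_ifs
    · simp
    · rw [HPoly.eval_apply, HPoly.of_apply]
      ring
  have hSn : ∀ n M, ‖S n M‖ ≤ r ^ 2 * ‖f‖ ^ k := by
    intro n M
    refine HPoly.norm_le (by positivity) fun y hy => ?_
    rw [hS, abs_mul, abs_pow]
    gcongr
    · rw [abs_of_nonneg (Finset.sum_nonneg fun j _ => by split_ifs <;> positivity)]
      refine (Finset.sum_le_sum fun j _ => ?_).trans ((hT M y).trans (mul_le_of_le_one_right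
        (sq_nonneg r) (pow_le_one₀ (norm_nonneg _) hy)))
      split_ifs
      · exact sq_nonneg _
      · exact le_rfl
    · exact (f.le_of_opNorm_le_of_le le_rfl hy).trans_eq (mul_one _)
  have hif : ∀ n y, Summable fun j => if j < n then 0 else T j y ^ 2 := fun n y =>
    (hsum y).of_nonneg_of_le (fun j => by split_ifs <;> positivity) fun j => by
      split_ifs
      · exact sq_nonneg _
      · exact le_rfl
  choose R hR using fun n => HPoly.exists_eq_of_tendsto (S n) (hSn n)
    (fun y => (∑' j, if j < n then 0 else T j y ^ 2) * f y ^ k) fun y => by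
      simp only [hS]
      exact (hif n y).hasSum.tendsto_sum_nat.mul_const _
  have htail : ∀ n y, (∑' j, if j < n then 0 else T j y ^ 2) = ∑' j, T (j + n) y ^ 2 := by
    intro n y
    rw [← (hif n y).sum_add_tsum_nat_add n, Finset.sum_eq_zero, zero_add]
    · simp
    · intro j hj
      rw [if_pos (Finset.mem_range.mp hj)]
  have hRn : ∀ n, ‖R n‖ ≤ r ^ 2 * ‖f‖ ^ k := by
    intro n
    refine HPoly.norm_le (by positivity) fun y hy => ?_
    rw [hR]
    refine le_of_tendsto (((hif n y).hasSum.tendsto_sum_nat.mul_const (f y ^ k)).abs)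
      (Eventually.of_forall fun M => ?_)
    rw [← hS]
    exact ((S n M).abs_apply_le y).trans ((mul_le_of_le_one_right (norm_nonneg _)
      (pow_le_one₀ (norm_nonneg _) hy)).trans (hSn n M))
  refine not_eventually_le_of_weaklyCompact hWC R hRn (fun y => ?_) (fun m => x m + u)
    (r := 1 + ‖u‖) (fun m => (norm_add_le _ _).trans (by gcongr; exact hx m))
    (c := (δ / 2) ^ 2) (by positivity) (Eventually.of_forall fun n => ?_)
  · simp only [hR, htail]
    simpa using (tendsto_sum_nat_add fun j => T j y ^ 2).mul_const (f y ^ k)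
  · have h0 : ∀ᶠ m in atTop, T m u ^ 2 < (δ / 2) ^ 2 :=
      (hsum u).tendsto_atTop_zero.eventually (gt_mem_nhds (by positivity))
    filter_upwards [h0, eventually_ge_atTop n] with m hm hnm
    have h1 : δ / 2 ≤ T m (x m + u) := by
      have := abs_lt_of_sq_lt_sq hm (by positivity)
      rw [map_add]
      linarith [hTx m, (abs_lt.mp this).1]
    have h2 : 1 ≤ f (x m + u) := by
      have : |f (x m)| ≤ ‖f‖ := (f.le_of_opNorm_le_of_le le_rfl (hx m)).trans_eq (mul_one _)
      rw [map_add, hu]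
      linarith [(abs_le.mp this).1]
    have h3 : T m (x m + u) ^ 2 ≤ ∑' j, if j < n then 0 else T j (x m + u) ^ 2 := by
      have := (hif n (x m + u)).le_tsum m fun j _ => by split_ifs <;> positivity
      rwa [if_neg hnm.not_gt] at this
    rw [hR]
    calc (δ / 2) ^ 2 ≤ T m (x m + u) ^ 2 := by gcongr
      _ ≤ _ := h3
      _ ≤ _ := le_mul_of_one_le_right ((sq_nonneg _).trans h3) (one_le_pow₀ h2)

theorem reflexive_of_weaklyCompact [CompleteSpace E] (hk : 1 < k)
    (hWC : ∀ Q : E → C₀(ℕ, ℝ), IsHomogPoly k Q → WeaklyCompactMap Q) :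
    Function.Surjective (inclusionInDoubleDual ℝ E) := by
  obtain ⟨l, rfl⟩ : ∃ l, k = l + 2 := ⟨k - 2, by omega⟩
  by_contra hnr
  obtain ⟨f, x, r, hf, hx, h1, h2⟩ := exists_triangular_of_not_reflexive hnr
  by_cases hcase : ∀ δ : ℝ, 0 < δ → ∀ g, IsConvexBlock g f → ∃ e, IsConvexBlock e g ∧
      ∀ x, ‖x‖ ≤ 1 → ∃ i, ∀ n l, i ≤ n → i ≤ l → e n x - e l x ≤ δ
  · obtain ⟨d, φ, hd, hφ⟩ := exists_convexBlock_tendsto f hf hcase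
    exact not_tendsto_convexBlock_of_weaklyCompact hWC hf hx h1 h2 hd φ hφ
  · push Not at hcase
    obtain ⟨δ, hδ, g, hg, hosc⟩ := hcase
    have hgr : ∀ n, ‖g n‖ ≤ r := fun n => by
      simpa using hg.mem_of_forall (convex_closedBall 0 r) (n := n) fun j _ => by simpa using hf j
    obtain ⟨T, y, hy, hTy, hT⟩ := exists_square_bounded_system hgr hosc
    refine not_square_bounded_system_of_weaklyCompact hWC (f := f 0) ?_ (half_pos hδ) hy hTy hT
    intro h0
    have := h1 0 0 le_rfl
    rw [h0, zero_apply] at this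
    norm_num at this

end ReflexiveDomain

section SeparableProjection

variable {W : Type*} [NormedAddCommGroup W] [NormedSpace ℝ W]

theorem exists_countable_norming {G : Set W} (hG : G.Countable) :
    ∃ D : Set (StrongDual ℝ W), D.Countable ∧
      ∀ g ∈ Submodule.span ℝ G, ∃ f ∈ D, ‖f‖ ≤ 1 ∧ ‖g‖ / 2 ≤ f g := by
  obtain ⟨c, hc, hGc⟩ := hG.isSeparable.span (R := ℝ)
  choose f hf hfx using fun x : W => exists_dual_vector'' ℝ x
  refine ⟨f '' insert 0 c, (hc.insert 0).image f, fun g hg => ?_⟩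
  obtain ⟨x, hx, hxg⟩ : ∃ x ∈ insert 0 c, ‖x - g‖ ≤ ‖g‖ / 4 := by
    rcases eq_or_ne g 0 with rfl | hg0
    · exact ⟨0, Set.mem_insert _ _, by simp⟩
    · obtain ⟨x, hx, hd⟩ := Metric.mem_closure_iff.mp (hGc hg) (‖g‖ / 4)
        (by have := norm_pos_iff.mpr hg0; positivity)
      exact ⟨x, Set.mem_insert_of_mem _ hx, by rw [dist_comm, dist_eq_norm] at hd; exact hd.le⟩
  refine ⟨f x, ⟨x, hx, rfl⟩, hf x, ?_⟩
  have h1 : f x x = ‖x‖ := hfx x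
  have h2 : f x (x - g) ≤ ‖g‖ / 4 := (le_abs_self _).trans
    (((f x).le_of_opNorm_le_of_le (hf x) hxg).trans_eq (one_mul _))
  rw [map_sub, h1] at h2
  have h3 : ‖g‖ ≤ ‖x‖ + ‖x - g‖ := by
    simpa [norm_sub_rev] using norm_le_insert' g x
  linarith

theorem exists_countable_norming_of_reflexive
    (hr : Function.Surjective (inclusionInDoubleDual ℝ W)) {D : Set (StrongDual ℝ W)}
    (hD : D.Countable) : ∃ G : Set W, G.Countable ∧
      ∀ f ∈ Submodule.span ℝ D, ∃ g ∈ G, ‖g‖ ≤ 1 ∧ ‖f‖ / 2 ≤ f g := by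
  obtain ⟨Z, hZ, hZD⟩ := exists_countable_norming hD
  choose j hj using hr
  refine ⟨j '' Z, hZ.image j, fun f hf => ?_⟩
  obtain ⟨z, hz, hz1, hzf⟩ := hZD f hf
  refine ⟨j z, ⟨z, hz, rfl⟩, ?_, ?_⟩
  · have := (inclusionInDoubleDualLi ℝ (E := W)).norm_map (j z)
    rw [← this]
    exact (congrArg norm (hj z)).trans_le hz1
  · rw [← dual_def ℝ W (j z) f, hj]
    exact hzf

theorem exists_norming_pair (hr : Function.Surjective (inclusionInDoubleDual ℝ W))
    {S : Set W} (hS : S.Countable) : ∃ (G : Set W) (D : Set (StrongDual ℝ W)), S ⊆ G ∧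
      G.Countable ∧ (∀ g ∈ Submodule.span ℝ G, ∃ f ∈ D, ‖f‖ ≤ 1 ∧ ‖g‖ / 2 ≤ f g) ∧
      ∀ f ∈ Submodule.span ℝ D, ∃ g ∈ G, ‖g‖ ≤ 1 ∧ ‖f‖ / 2 ≤ f g := by
  choose d hd hdn using fun G : {G : Set W // G.Countable} => exists_countable_norming G.2
  choose e he hen using fun D : {D : Set (StrongDual ℝ W) // D.Countable} =>
    exists_countable_norming_of_reflexive hr D.2
  let p : ℕ → {G : Set W // G.Countable} × {D : Set (StrongDual ℝ W) // D.Countable} := fun n =>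
    Nat.rec (⟨S, hS⟩, ⟨∅, Set.countable_empty⟩)
      (fun _ q => (⟨q.1.1 ∪ e q.2, q.1.2.union (he q.2)⟩,
        ⟨q.2.1 ∪ d q.1, q.2.2.union (hd q.1)⟩)) n
  have hG : Monotone fun n => (p n).1.1 := monotone_nat_of_le_succ fun n => Set.subset_union_left
  have hD : Monotone fun n => (p n).2.1 := monotone_nat_of_le_succ fun n => Set.subset_union_left
  have hspan : ∀ {V : Type _} [AddCommGroup V] [Module ℝ V] (s : ℕ → Set V), Monotone s →
      ∀ v ∈ Submodule.span ℝ (⋃ n, s n), ∃ n, v ∈ Submodule.span ℝ (s n) := by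
    intro V _ _ s hs v hv
    rw [Submodule.span_iUnion] at hv
    exact (Submodule.mem_iSup_of_directed _
      (Monotone.directed_le fun a b hab => Submodule.span_mono (hs hab))).mp hv
  refine ⟨⋃ n, (p n).1.1, ⋃ n, (p n).2.1, Set.subset_iUnion (fun n => (p n).1.1) 0,
    Set.countable_iUnion fun n => (p n).1.2, fun g hg => ?_, fun f hf => ?_⟩
  · obtain ⟨n, hn⟩ := hspan _ hG g hg
    obtain ⟨f, hf, h⟩ := hdn (p n).1 g hn
    exact ⟨f, Set.mem_iUnion.mpr ⟨n + 1, Set.mem_union_right _ hf⟩, h⟩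
  · obtain ⟨n, hn⟩ := hspan _ hD f hf
    obtain ⟨g, hg, h⟩ := hen (p n).2 f hn
    exact ⟨g, Set.mem_iUnion.mpr ⟨n + 1, Set.mem_union_right _ hg⟩, h⟩

/-- In a reflexive space every countable set is fixed by a bounded operator with separable range. -/
theorem exists_separable_projection [CompleteSpace W]
    (hr : Function.Surjective (inclusionInDoubleDual ℝ W)) {S : Set W} (hS : S.Countable) :
    ∃ V : W →L[ℝ] W, (∀ x ∈ S, V x = x) ∧ TopologicalSpace.IsSeparable (Set.range V) := by
  obtain ⟨G, D, hSG, hGc, hGn, hDn⟩ := exists_norming_pair hr hS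
  let A : Submodule ℝ W := (Submodule.span ℝ G).topologicalClosure
  let B : Submodule ℝ W := ⨅ f ∈ D, LinearMap.ker f.toLinearMap
  have hBmem : ∀ x, x ∈ B ↔ ∀ f ∈ D, f x = 0 := fun x => by simp [B]
  have hA : IsClosed (A : Set W) := Submodule.isClosed_topologicalClosure _
  have hB : IsClosed (B : Set W) := by
    have : (B : Set W) = ⋂ f ∈ D, {x | f x = 0} := by ext x; simp [hBmem]
    rw [this]
    exact isClosed_biInter fun f _ => isClosed_eq f.continuous continuous_const
  have hGA : ∀ g ∈ G, g ∈ A := fun g hg =>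
    Submodule.le_topologicalClosure _ (Submodule.subset_span hg)
  have hAB : ∀ a ∈ A, ∀ b ∈ B, ‖a‖ ≤ 2 * ‖a + b‖ := by
    intro a ha b hb
    refine closure_minimal (t := {a | ‖a‖ ≤ 2 * ‖a + b‖}) (fun g hg => ?_)
      (isClosed_le continuous_norm (by fun_prop)) ha
    obtain ⟨f, hf, hf1, hfg⟩ := hGn g hg
    have h1 : f (g + b) = f g := by rw [map_add, (hBmem b).mp hb f hf, add_zero]
    have h2 := (le_abs_self _).trans (f.le_of_opNorm_le hf1 (g + b))
    rw [h1, one_mul] at h2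
    change ‖g‖ ≤ _
    linarith
  have : CompleteSpace A := hA.completeSpace_coe
  have : CompleteSpace B := hB.completeSpace_coe
  let T : (A × B) →L[ℝ] W := A.subtypeL.coprod B.subtypeL
  have hT : ∀ z, T z = z.1 + z.2 := fun _ => rfl
  have hanti : AntilipschitzWith 3 T := by
    refine AddMonoidHomClass.antilipschitz_of_bound T fun z => ?_
    have h1 := hAB z.1 z.1.2 z.2 z.2.2
    have h2 : ‖(z.2 : W)‖ ≤ ‖(z.1 : W) + z.2‖ + ‖(z.1 : W)‖ := by
      have := norm_sub_le ((z.1 : W) + z.2) z.1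
      rwa [add_sub_cancel_left] at this
    rw [hT, Prod.norm_def]
    have h3 := norm_nonneg ((z.1 : W) + z.2)
    refine max_le ?_ ?_ <;> rw [Submodule.coe_norm] <;> push_cast <;> linarith
  have hinj : LinearMap.ker T.toLinearMap = ⊥ := LinearMap.ker_eq_bot.mpr hanti.injective
  have hclosed : IsClosed (LinearMap.range T.toLinearMap : Set W) :=
    hanti.isClosed_range T.uniformContinuous
  have hsurj : LinearMap.range T.toLinearMap = ⊤ := by
    rw [eq_top_iff]
    intro w _
    by_contra hw
    obtain ⟨f, hf0, hf1⟩ := exists_dual_eq_zero_of_notMem hclosed hw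
    have hfA : ∀ a ∈ A, f a = 0 := fun a ha => hf0 a ⟨(⟨a, ha⟩, 0), by simp [hT]⟩
    have hfB : ∀ b ∈ B, f b = 0 := fun b hb => hf0 b ⟨(0, ⟨b, hb⟩), by simp [hT]⟩
    have hfD : f ∈ (Submodule.span ℝ D).topologicalClosure := by
      by_contra hfD
      obtain ⟨ξ, hξ0, hξ1⟩ := exists_dual_eq_zero_of_notMem
        (Submodule.isClosed_topologicalClosure _) hfD
      obtain ⟨x, rfl⟩ := hr ξ
      have hx : x ∈ B := (hBmem x).mpr fun f hf =>
        hξ0 f (Submodule.le_topologicalClosure _ (Submodule.subset_span hf))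
      rw [dual_def, hfB x hx] at hξ1
      exact zero_ne_one hξ1
    have hfz : ‖f‖ ≤ 0 := by
      refine le_of_forall_pos_le_add fun ε hε => ?_
      obtain ⟨f', hf', hd⟩ := Metric.mem_closure_iff.mp hfD (ε / 3) (by positivity)
      obtain ⟨g, hg, hg1, hgf⟩ := hDn f' hf'
      rw [dist_eq_norm] at hd
      have h1 := (le_abs_self _).trans ((f' - f).le_of_opNorm_le_of_le le_rfl hg1)
      rw [sub_apply, hfA g (hGA g hg), norm_sub_rev] at h1
      have h2 := norm_le_insert' f f'
      linarith
    rw [norm_le_zero_iff.mp hfz, zero_apply] at hf1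
    exact zero_ne_one hf1
  let e := ContinuousLinearEquiv.ofBijective T hinj hsurj
  refine ⟨A.subtypeL ∘L ContinuousLinearMap.fst ℝ A B ∘L (e.symm : W →L[ℝ] A × B), fun x hx => ?_,
    (hGc.isSeparable.span (R := ℝ)).closure.mono ?_⟩
  · have h1 : e (⟨x, hGA x (hSG hx)⟩, 0) = x := by
      change T _ = x
      simp [hT]
    have h2 : e.symm x = (⟨x, hGA x (hSG hx)⟩, 0) :=
      (congrArg e.symm h1).symm.trans (e.symm_apply_apply _)
    simp [h2]
  · rintro _ ⟨x, rfl⟩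
    exact (e.symm x).1.2

end SeparableProjection

section PolynomialReflexivity

variable {k : ℕ} {E : Type*} [NormedAddCommGroup E] [NormedSpace ℝ E]

namespace HPoly

theorem continuous (P : HPoly k E) : Continuous fun x => P x := homogPoly_continuous P.2

theorem exists_subseq_tendsto {S : Set E} (hS : TopologicalSpace.IsSeparable S)
    (P : ℕ → HPoly k E) {C : ℝ} (hP : ∀ n, ‖P n‖ ≤ C) :
    ∃ φ : ℕ → ℕ, StrictMono φ ∧ ∃ Q : HPoly k E,
      ∀ x ∈ S, Tendsto (fun i => P (φ i) x) atTop (𝓝 (Q x)) := by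
  obtain ⟨D, hD, hSD⟩ := hS
  have : Countable D := hD.to_subtype
  have hK : IsCompact (Set.univ.pi fun d : D => Metric.closedBall (0 : ℝ) (C * ‖(d : E)‖ ^ k)) :=
    isCompact_univ_pi fun _ => isCompact_closedBall _ _
  obtain ⟨q, -, φ, hφ, hq⟩ := hK.tendsto_subseq (x := fun n (d : D) => P n d) fun n d _ => by
    rw [mem_closedBall_zero_iff]
    exact ((P n).abs_apply_le d).trans (by gcongr; exact hP n)
  have hq' := tendsto_pi_nhds.mp hq
  obtain ⟨Q, hQ⟩ := exists_tendsto_ultrafilter (hyperfilter ℕ) (P ∘ φ) fun n => hP (φ n)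
  have hagree : ∀ d : D, Q d = q d := fun d => tendsto_nhds_unique (hQ d) ((hq' d).mono_left
    (by rw [← Nat.cofinite_eq_atTop]; exact hyperfilter_le_cofinite))
  refine ⟨φ, hφ, Q, fun x hx => tendsto_iff_ultrafilter _ _ _ |>.mpr fun 𝒰 h𝒰 => ?_⟩
  obtain ⟨R, hR⟩ := exists_tendsto_ultrafilter 𝒰 (P ∘ φ) fun n => hP (φ n)
  have hRQ : Set.EqOn (fun x => R x) (fun x => Q x) D := fun d hd =>
    (tendsto_nhds_unique (hR d) ((hq' ⟨d, hd⟩).mono_left h𝒰)).trans (hagree ⟨d, hd⟩).symm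
  have h1 : R x = Q x := hRQ.closure R.continuous Q.continuous (hSD hx)
  rw [← h1]
  exact hR x

theorem tendsto_of_mem_span_eval {ι : Type*} {l : Filter ι} {S : Set E}
    {u : StrongDual ℝ (HPoly k E)} (hu : u ∈ Submodule.span ℝ (eval k '' S))
    {P : ι → HPoly k E} {Q : HPoly k E} (h : ∀ x ∈ S, Tendsto (fun i => P i x) l (𝓝 (Q x))) :
    Tendsto (fun i => u (P i)) l (𝓝 (u Q)) := by
  induction hu using Submodule.span_induction with
  | mem u hu => obtain ⟨x, hx, rfl⟩ := hu; exact h x hx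
  | zero => exact tendsto_const_nhds
  | add u v _ _ hu hv => exact hu.add hv
  | smul c u _ hu => exact hu.const_mul c

theorem apply_eq_of_mem_span_eval {S : Set E} {u : StrongDual ℝ (HPoly k E)}
    (hu : u ∈ Submodule.span ℝ (eval k '' S)) {P Q : HPoly k E} (h : ∀ x ∈ S, P x = Q x) :
    u P = u Q := by
  induction hu using Submodule.span_induction with
  | mem u hu => obtain ⟨x, hx, rfl⟩ := hu; exact h x hx
  | zero => rfl
  | add u v _ _ hu hv => exact congrArg₂ (· + ·) hu hv
  | smul c u _ hu => exact congrArg (c * ·) hu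

theorem exists_finset_mem_span_eval {u : StrongDual ℝ (HPoly k E)}
    (hu : u ∈ Submodule.span ℝ (Set.range (eval k : E → _))) :
    ∃ F : Finset E, u ∈ Submodule.span ℝ (eval k '' (F : Set E)) := by
  classical
  obtain ⟨T, hT, huT⟩ := Submodule.mem_span_finite_of_mem_span hu
  rw [← Set.image_univ, Finset.subset_set_image_iff] at hT
  obtain ⟨F, -, rfl⟩ := hT
  exact ⟨F, by rwa [Finset.coe_image] at huT⟩

/-- A bounded set of finite combinations of evaluations, norming enough to dominate `η`. -/
theorem exists_convex_dominating (η : StrongDual ℝ (HPoly k E)) :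
    ∃ U : Set (StrongDual ℝ (HPoly k E)), Convex ℝ U ∧
      (∀ w c, (∀ u ∈ U, u w ≤ c) → η w ≤ c) ∧ (∀ u ∈ U, ‖u‖ ≤ ‖η‖) ∧
      ∀ u ∈ U, u ∈ Submodule.span ℝ (Set.range (eval k : E → _)) := by
  let V : Set (StrongDual ℝ (HPoly k E)) :=
    {u | ∃ x : E, ‖x‖ ≤ 1 ∧ (u = ‖η‖ • eval k x ∨ u = -(‖η‖ • eval k x))}
  refine ⟨convexHull ℝ V, convex_convexHull ℝ V, fun w c h => ?_, fun u hu => ?_, fun u hu => ?_⟩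
  · have h1 : ∀ x : E, ‖x‖ ≤ 1 → |‖η‖ * w x| ≤ c := fun x hx => abs_le'.mpr
      ⟨h _ (subset_convexHull ℝ V ⟨x, hx, Or.inl rfl⟩),
        h _ (subset_convexHull ℝ V ⟨x, hx, Or.inr rfl⟩)⟩
    have h2 : ‖‖η‖ • w‖ ≤ c := norm_le ((abs_nonneg _).trans (h1 0 (by simp))) h1
    rw [norm_smul, norm_norm] at h2
    exact ((le_abs_self _).trans (η.le_opNorm w)).trans h2
  · rw [← mem_closedBall_zero_iff]
    refine convexHull_min ?_ (convex_closedBall _ _) hu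
    rintro u ⟨x, hx, hu⟩
    have h1 : ‖‖η‖ • eval k x‖ ≤ ‖η‖ := by
      rw [norm_smul, norm_norm]
      exact mul_le_of_le_one_right (norm_nonneg _)
        ((norm_eval_le x).trans (pow_le_one₀ (norm_nonneg _) hx))
    rw [mem_closedBall_zero_iff]
    rcases hu with rfl | rfl
    · exact h1
    · rwa [norm_neg]
  · refine convexHull_min ?_ (Submodule.convex _) hu
    rintro u ⟨x, hx, hu⟩
    have h1 : ‖η‖ • eval k x ∈ Submodule.span ℝ (Set.range (eval k : E → _)) :=
      Submodule.smul_mem _ _ (Submodule.subset_span ⟨x, rfl⟩)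
    rcases hu with rfl | rfl
    · exact h1
    · exact Submodule.neg_mem _ h1

/-- Over a reflexive space, weak compactness of all polynomials into `c₀` rules out triangular
systems pairing bounded polynomials with finite combinations of evaluations. -/
theorem false_of_triangular_system [CompleteSpace E]
    (hr : Function.Surjective (inclusionInDoubleDual ℝ E))
    (hWC : ∀ Q : E → C₀(ℕ, ℝ), IsHomogPoly k Q → WeaklyCompactMap Q)
    (P : ℕ → HPoly k E) (u : ℕ → StrongDual ℝ (HPoly k E)) {C R : ℝ} (hP : ∀ n, ‖P n‖ ≤ C)
    (hu : ∀ m, ‖u m‖ ≤ R)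
    (hspan : ∀ m, u m ∈ Submodule.span ℝ (Set.range (eval k : E → _)))
    (hge : ∀ n m, n ≤ m → 3 / 4 ≤ u m (P n)) (hle : ∀ m n, m < n → u m (P n) ≤ 1 / 8) :
    False := by
  choose F hF using fun m => exists_finset_mem_span_eval (hspan m)
  obtain ⟨V, hV, hVs⟩ := exists_separable_projection hr
    (Set.countable_iUnion fun m => (F m).countable_toSet)
  have hVF : ∀ m, ∀ x ∈ (F m : Set E), V x = x := fun m x hx =>
    hV x (Set.mem_iUnion.mpr ⟨m, hx⟩)
  obtain ⟨φ, hφ, Q, hQ⟩ := exists_subseq_tendsto hVs P hP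
  have hQV : ∀ x, Tendsto (fun i => (P (φ i)).comp V x) atTop (𝓝 (Q.comp V x)) := fun x =>
    hQ (V x) ⟨x, rfl⟩
  have huV : ∀ m n, u m ((P n).comp V) = u m (P n) := fun m n =>
    apply_eq_of_mem_span_eval (hF m) fun x hx => by rw [comp_apply, hVF m x hx]
  obtain ⟨ζ, hζ⟩ := exists_forall_tendsto_ultrafilter (hyperfilter ℕ) u hu
  have hζP : ∀ n, 3 / 4 ≤ ζ ((P n).comp V) := fun n =>
    ge_of_tendsto (hζ _) ((hyperfilter_le_cofinite.trans_eq Nat.cofinite_eq_atTop)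
      ((eventually_ge_atTop n).mono fun m hm => by rw [huV]; exact hge n m hm))
  have hζQ : ζ (Q.comp V) ≤ 1 / 8 := le_of_tendsto (hζ _) (Eventually.of_forall fun m =>
    le_of_tendsto (tendsto_of_mem_span_eval (hF m) fun x _ => hQV x)
      ((hφ.tendsto_atTop.eventually_gt_atTop m).mono fun i hi => by
        rw [huV]; exact hle m _ hi))
  have hC : 0 ≤ C := (norm_nonneg _).trans (hP 0)
  have h0 := tendsto_dual_of_weaklyCompact hWC (fun i => (P (φ i)).comp V - Q.comp V)
    (C := C * ‖V‖ ^ k + ‖Q.comp V‖)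
    (fun i => (norm_sub_le _ _).trans (by
      gcongr
      exact (norm_comp_le _ _).trans (by gcongr; exact hP _)))
    (fun x => by simpa using (hQV x).sub_const (Q.comp V x)) ζ
  have h1 := ge_of_tendsto' h0 (b := 5 / 8) fun i => by
    rw [map_sub]; linarith [hζP (φ i)]
  norm_num at h1

theorem reflexive_of_weaklyCompact [CompleteSpace E] (hk : 1 < k)
    (hWC : ∀ Q : E → C₀(ℕ, ℝ), IsHomogPoly k Q → WeaklyCompactMap Q) :
    Function.Surjective (inclusionInDoubleDual ℝ (HPoly k E)) := by
  intro ξ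
  refine ⟨ofBidual ξ, ?_⟩
  by_contra hne
  set ξ' := ξ - inclusionInDoubleDual ℝ (HPoly k E) (ofBidual ξ) with hξ'
  obtain ⟨η, hη⟩ : ∃ η, ξ' η ≠ 0 := by
    by_contra! h
    exact hne (sub_eq_zero.mp (ContinuousLinearMap.ext h)).symm
  have hη1 : ξ' ((ξ' η)⁻¹ • η) = 1 := by rw [map_smul, smul_eq_mul, inv_mul_cancel₀ hη]
  obtain ⟨U, hU, hdom, hnorm, hspan⟩ := exists_convex_dominating ((ξ' η)⁻¹ • η)
  have hzero : ∀ u ∈ U, ξ' u = 0 := fun u hu => by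
    have h1 : Submodule.span ℝ (Set.range (eval k : E → _)) ≤ LinearMap.ker ξ'.toLinearMap := by
      rw [Submodule.span_le]
      rintro _ ⟨x, rfl⟩
      simp [hξ']
    exact h1 (hspan u hu)
  obtain ⟨P, u, hP, huU, hge, hle⟩ := exists_triangular_system hU _ hdom ξ' hη1 hzero
  exact false_of_triangular_system (_root_.reflexive_of_weaklyCompact hk hWC) hWC P u hP
    (fun m => hnorm _ (huU m)) (fun m => hspan _ (huU m)) hge hle

end HPoly

end PolynomialReflexivity

/-- For `k > 1`, every continuous `k`-homogeneous polynomial from `E` into `c₀` is weakly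
compact if and only if the space `P(ᵏE)` of continuous scalar-valued `k`-homogeneous
polynomials on `E` is reflexive. -/
theorem homog_poly_weakly_compact_iff_reflexive
    (E : Type*) [NormedAddCommGroup E] [NormedSpace ℝ E] [CompleteSpace E]
    (k : ℕ) (hk : 1 < k) :
    (∀ P : E → C₀(ℕ, ℝ), IsHomogPoly k P → WeaklyCompactMap P) ↔
      Function.Surjective (NormedSpace.inclusionInDoubleDual ℝ (homogPolySp k E)) :=
  ⟨fun hWC => HPoly.reflexive_of_weaklyCompact hk hWC,
    fun hr _ hP => weaklyCompactMap_of_reflexive hr hP⟩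
end
end
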